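/- arXiv:2004.03131 — 2 statements merged into one kernel-verified Lean document; each statement's English description precedes it below -/
import Mathlib

section
/- There exists an absolute constant n₀ such that for every n ≥ n₀ and every p with (4 ln n)/n ≤ p ≤ 1/4 the following holds. Let M be an n×n Bernoulli(p) random matrix. Then for every t ≥ 30, P{‖M − E M‖ ≥ 2t√(np)} ≤ 4·exp(−t²pn/4) and P{‖M‖ ≥ 2t√(np) + pn} ≤ 4·exp(−t²pn/4), where ‖·‖ is the operator (spectral) norm. In particular, P{‖M·𝟏‖ ≥ 3p·n^{3/2}} ≤ 4·exp(−n²p²/4), where 𝟏 = (1,…,1) and ‖M·𝟏‖ is the Euclidean norm. -/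
open MeasureTheory

/-- Euclidean norm of a vector in `ℝⁿ`. -/
noncomputable def eNorm {n : ℕ} (x : Fin n → ℝ) : ℝ := Real.sqrt (∑ i, (x i) ^ 2)

/-- The operator (spectral) norm of an `n × n` real matrix, as an operator `ℓ₂ⁿ → ℓ₂ⁿ`. -/
noncomputable def matNorm {n : ℕ} (A : Matrix (Fin n) (Fin n) ℝ) : ℝ :=
  sSup {r | ∃ x : Fin n → ℝ, eNorm x ≤ 1 ∧ r = eNorm (A.mulVec x)}

/-- `M` is a random `n × n` matrix with i.i.d. Bernoulli(p) entries. -/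
def IsBernoulliMatrix {Ω : Type*} [MeasurableSpace Ω] (μ : Measure Ω) {n : ℕ}
    (M : Ω → Matrix (Fin n) (Fin n) ℝ) (p : ℝ) : Prop :=
  (∀ ω i j, M ω i j = 0 ∨ M ω i j = 1) ∧
  ∀ A : Matrix (Fin n) (Fin n) ℝ, (∀ i j, A i j = 0 ∨ A i j = 1) →
    μ {ω | M ω = A} =
      ENNReal.ofReal
        (p ^ (Finset.univ.filter (fun ij : Fin n × Fin n => A ij.1 ij.2 = 1)).card *
          (1 - p) ^ (Finset.univ.filter (fun ij : Fin n × Fin n => A ij.1 ij.2 = 0)).card)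


/-- weights of a Bernoulli(p) variable -/
noncomputable def bw (p : ℝ) (b : Bool) : ℝ := if b then p else 1 - p

/-- expectation over i.i.d. Bernoulli(p) bits -/
noncomputable def Ex (p : ℝ) {ι : Type*} [Fintype ι] [DecidableEq ι] (f : (ι → Bool) → ℝ) : ℝ :=
  ∑ a : ι → Bool, (∏ e, bw p (a e)) * f a

lemma bw_nonneg {p : ℝ} (h0 : 0 ≤ p) (h1 : p ≤ 1) (b : Bool) : 0 ≤ bw p b := by
  cases b <;> simp [bw] <;> linarith

section exbasic
variable {p : ℝ} {ι : Type*} [Fintype ι] [DecidableEq ι]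

lemma Ex_prod (g : ι → Bool → ℝ) :
    Ex p (fun a : ι → Bool => ∏ e, g e (a e)) = ∏ e, (p * g e true + (1 - p) * g e false) := by
  have := Finset.prod_univ_sum (fun _ : ι => (Finset.univ : Finset Bool)) (fun e b => bw p b * g e b)
  simp only [Fintype.piFinset_univ] at this
  rw [Ex]
  simp_rw [← Finset.prod_mul_distrib]
  rw [← this]
  simp [bw]

lemma Ex_mono (h0 : 0 ≤ p) (h1 : p ≤ 1) {f g : (ι → Bool) → ℝ} (h : ∀ a, f a ≤ g a) :
    Ex p f ≤ Ex p g :=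
  Finset.sum_le_sum fun a _ => mul_le_mul_of_nonneg_left (h a)
    (Finset.prod_nonneg fun _ _ => bw_nonneg h0 h1 _)

lemma Ex_add (f g : (ι → Bool) → ℝ) : Ex p (fun a => f a + g a) = Ex p f + Ex p g := by
  simp [Ex, mul_add, Finset.sum_add_distrib]

lemma Ex_mul_left (c : ℝ) (f : (ι → Bool) → ℝ) : Ex p (fun a => c * f a) = c * Ex p f := by
  simp only [Ex, Finset.mul_sum]
  exact Finset.sum_congr rfl fun _ _ => by ring

lemma Ex_sum {κ : Type*} (s : Finset κ) (f : κ → (ι → Bool) → ℝ) :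
    Ex p (fun a => ∑ k ∈ s, f k a) = ∑ k ∈ s, Ex p (f k) := by
  simp only [Ex, Finset.mul_sum]
  rw [Finset.sum_comm]

lemma Ex_one : Ex p (fun _ : ι → Bool => 1) = 1 := by
  have := Ex_prod (p := p) (fun (_ : ι) (_ : Bool) => (1:ℝ))
  simpa using this

lemma Ex_const (c : ℝ) : Ex p (fun _ : ι → Bool => c) = c := by
  have := Ex_mul_left (p := p) (ι := ι) c (fun _ => 1)
  rw [Ex_one] at this
  simpa using this

lemma Ex_nonneg (h0 : 0 ≤ p) (h1 : p ≤ 1) {f : (ι → Bool) → ℝ} (h : ∀ a, 0 ≤ f a) :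
    0 ≤ Ex p f :=
  Finset.sum_nonneg fun a _ => mul_nonneg
    (Finset.prod_nonneg fun _ _ => bw_nonneg h0 h1 _) (h a)

lemma Ex_exp_pos (h0 : 0 ≤ p) (h1 : p ≤ 1) (f : (ι → Bool) → ℝ) :
    0 < Ex p (fun a => Real.exp (f a)) := by
  obtain ⟨m, hm⟩ := Finite.exists_min f
  have : Ex p (fun _ : ι → Bool => Real.exp (f m)) ≤ Ex p (fun a => Real.exp (f a)) :=
    Ex_mono h0 h1 fun a => Real.exp_le_exp.2 (hm a)
  rw [Ex_const] at this
  exact lt_of_lt_of_le (Real.exp_pos _) this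

/-- log-convexity of exponential moments -/
lemma Ex_holder (h0 : 0 ≤ p) (h1 : p ≤ 1) (u v : (ι → Bool) → ℝ) (α β s : ℝ) (hs : 0 ≤ s)
    (hs1 : s ≤ 1) (hu : Ex p (fun a => Real.exp (u a)) ≤ Real.exp α)
    (hv : Ex p (fun a => Real.exp (v a)) ≤ Real.exp β) :
    Ex p (fun a => Real.exp ((1 - s) * u a + s * v a)) ≤ Real.exp ((1 - s) * α + s * β) := by
  have key : ∀ a, Real.exp ((1 - s) * u a + s * v a) ≤ Real.exp ((1 - s) * α + s * β) *
      (((1 - s) * Real.exp (-α)) * Real.exp (u a) + (s * Real.exp (-β)) * Real.exp (v a)) := by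
    intro a
    have hc := convexOn_exp.2 (Set.mem_univ (u a - α)) (Set.mem_univ (v a - β))
      (sub_nonneg.2 hs1) hs (by ring)
    simp only [smul_eq_mul] at hc
    have e1 : Real.exp ((1 - s) * u a + s * v a) = Real.exp ((1 - s) * α + s * β) *
      Real.exp ((1 - s) * (u a - α) + s * (v a - β)) := by
      rw [← Real.exp_add]; congr 1; ring
    rw [e1]
    apply mul_le_mul_of_nonneg_left _ (Real.exp_pos _).le
    have e2 : Real.exp (u a - α) = Real.exp (-α) * Real.exp (u a) := by
      rw [← Real.exp_add]; congr 1; ring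
    have e3 : Real.exp (v a - β) = Real.exp (-β) * Real.exp (v a) := by
      rw [← Real.exp_add]; congr 1; ring
    rw [e2, e3] at hc
    linarith
  refine (Ex_mono h0 h1 key).trans ?_
  rw [Ex_mul_left, Ex_add, Ex_mul_left, Ex_mul_left]
  have i1 : Real.exp (-α) * Ex p (fun a => Real.exp (u a)) ≤ 1 := by
    calc _ ≤ Real.exp (-α) * Real.exp α := by gcongr
      _ = 1 := by rw [← Real.exp_add]; simp
  have i2 : Real.exp (-β) * Ex p (fun a => Real.exp (v a)) ≤ 1 := by
    calc _ ≤ Real.exp (-β) * Real.exp β := by gcongr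
      _ = 1 := by rw [← Real.exp_add]; simp
  have : (1 - s) * Real.exp (-α) * Ex p (fun a => Real.exp (u a)) + s * Real.exp (-β) *
      Ex p (fun a => Real.exp (v a)) ≤ 1 := by nlinarith
  calc _ ≤ Real.exp ((1 - s) * α + s * β) * 1 := by gcongr
    _ = _ := by ring

lemma Ex_equiv {κ : Type*} [Fintype κ] [DecidableEq κ] (e : ι ≃ κ) (f : (ι → Bool) → ℝ) :
    Ex p f = Ex p (fun a : κ → Bool => f (a ∘ e)) := by
  rw [Ex, Ex, ← (e.arrowCongr (Equiv.refl Bool)).sum_comp]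
  refine Finset.sum_congr rfl fun a _ => ?_
  congr 1
  · rw [← e.prod_comp]; simp
  · congr 1; ext x; simp

end exbasic

lemma Ex_succ {p : ℝ} {N : ℕ} (f : (Fin (N+1) → Bool) → ℝ) :
    Ex p f = (1 - p) * Ex p (fun a => f (Fin.cons false a)) +
      p * Ex p (fun a => f (Fin.cons true a)) := by
  rw [Ex, ← (Fin.consEquiv (fun _ => Bool)).sum_comp, Fintype.sum_prod_type]
  simp [Fin.consEquiv, Fin.prod_univ_succ, bw, Ex, Finset.mul_sum, mul_assoc]
  ring

lemma exp_aux {a : ℝ} (h0 : 0 ≤ a) (h1 : a ≤ 1/2) :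
    Real.exp (a - a^2) + Real.exp (-a) ≤ 2 := by
  have hu0 : 0 ≤ a - a^2 := by nlinarith
  have hu1 : a - a^2 ≤ 1 := by nlinarith
  have b1 := Real.exp_bound' hu0 hu1 (n := 3) (by norm_num)
  have b2 : Real.exp (-a) ≤ 1 - a + a^2/2 := by
    have q := Real.quadratic_le_exp_of_nonneg h0
    have pos : 0 < 1 - a + a^2/2 := by nlinarith
    have : (1 - a + a^2/2)⁻¹ ≤ Real.exp a := by
      rw [inv_le_iff_one_le_mul₀ pos]
      nlinarith [sq_nonneg (a^2)]
    rw [Real.exp_neg]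
    exact inv_le_of_inv_le₀ pos this
  simp only [Finset.sum_range_succ, Finset.sum_range_zero, Nat.factorial] at b1
  norm_num at b1
  have h3 : (a - a^2)^2 ≤ a^2 * (1 - a) := by
    have : (a - a^2)^2 = a^2 * ((1-a)*(1-a)) := by ring
    rw [this]; apply mul_le_mul_of_nonneg_left _ (sq_nonneg a); nlinarith
  have h4 : (a - a^2)^3 ≤ a^3 := by
    apply pow_le_pow_left₀ hu0; nlinarith
  nlinarith [pow_nonneg h0 3]

lemma two_point_aux {p H0 H1 B0 B1 α β : ℝ} (hp0 : 0 ≤ p) (hp1 : p ≤ 1)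
    (hB0 : 0 ≤ B0) (hB1 : 0 ≤ B1)
    (hab : α ≤ β) (b0 : B0 ≤ Real.exp (-α)) (b1 : B1 ≤ Real.exp (-β))
    (h0 : H0 ≤ Real.exp α)
    (h1 : ∀ s, 0 ≤ s → s ≤ 1 → H1 ≤ Real.exp ((1 - s) * α + s * β + (1 - s)^2 / 4)) :
    ((1 - p) * H0 + p * H1) * ((1 - p) * B0 + p * B1) ≤ 1 := by
  obtain ⟨c, hc0, hc, hc1, hHc⟩ : ∃ c, 0 ≤ c ∧ c ≤ 1/2 ∧ c ≤ β - α ∧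
      H1 ≤ Real.exp (α + (c - c^2)) := by
    by_cases h : β - α ≤ 1/2
    · refine ⟨β - α, by linarith, h, le_rfl, ?_⟩
      convert h1 (1 - 2 * (β - α)) (by linarith) (by linarith) using 2
      ring
    · refine ⟨1/2, by norm_num, by norm_num, by linarith, ?_⟩
      convert h1 0 (by norm_num) (by norm_num) using 2
      ring
  have b1' : B1 ≤ Real.exp (-α) * Real.exp (-c) := by
    rw [← Real.exp_add]
    exact b1.trans (Real.exp_le_exp.2 (by linarith))
  rw [Real.exp_add] at hHc
  have hq : 0 ≤ 1 - p := by linarith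
  have e1 : Real.exp α * Real.exp (-α) = 1 := by rw [← Real.exp_add]; simp
  have e2 : Real.exp (c - c^2) * Real.exp (-c) ≤ 1 := by
    rw [← Real.exp_add]; apply Real.exp_le_one_iff.2; nlinarith
  have e3 := exp_aux hc0 hc
  calc _ ≤ ((1 - p) * Real.exp α + p * (Real.exp α * Real.exp (c - c^2))) *
        ((1 - p) * Real.exp (-α) + p * (Real.exp (-α) * Real.exp (-c))) := by gcongr
    _ = (Real.exp α * Real.exp (-α)) * ((1-p)^2 + p * (1-p) * (Real.exp (c - c^2) + Real.exp (-c))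
        + p^2 * (Real.exp (c - c^2) * Real.exp (-c))) := by ring
    _ ≤ 1 * ((1-p)^2 + p * (1-p) * 2 + p^2 * 1) := by rw [e1]; gcongr
    _ = 1 := by ring

/-- zero-one value -/
noncomputable def bv (b : Bool) : ℝ := if b then 1 else 0

/-- inf-convolution -/
noncomputable def Qc {N : ℕ} (f : (Fin N → ℝ) → ℝ) (x : Fin N → ℝ) : ℝ :=
  ⨅ y : Fin N → ℝ, (f y + (∑ i, (x i - y i)^2) / 4)

lemma Qc_le {N : ℕ} {f : (Fin N → ℝ) → ℝ} {c : ℝ} (hc : ∀ y, c ≤ f y) (x y : Fin N → ℝ) :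
    Qc f x ≤ f y + (∑ i, (x i - y i)^2) / 4 := by
  apply ciInf_le
  refine ⟨c, ?_⟩
  rintro _ ⟨y, rfl⟩
  have : 0 ≤ (∑ i, (x i - y i)^2) := Finset.sum_nonneg fun _ _ => sq_nonneg _
  have := hc y
  simp only
  linarith

lemma Qc_step {N : ℕ} {f : (Fin (N+1) → ℝ) → ℝ} {c : ℝ} (hc : ∀ y, c ≤ f y)
    (hf : ConvexOn ℝ Set.univ f) (x : Fin N → ℝ) (t s : ℝ) (hs : 0 ≤ s) (hs1 : s ≤ 1) :
    Qc f (Fin.cons t x) ≤ (1 - s) * Qc (fun y => f (Fin.cons 0 y)) x +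
      s * Qc (fun y => f (Fin.cons 1 y)) x + (t - s)^2 / 4 := by
  apply le_of_forall_pos_le_add
  intro ε hε
  obtain ⟨y0, hy0⟩ := exists_lt_of_ciInf_lt
    (show Qc (fun y => f (Fin.cons 0 y)) x < Qc (fun y => f (Fin.cons 0 y)) x + ε by linarith)
  obtain ⟨y1, hy1⟩ := exists_lt_of_ciInf_lt
    (show Qc (fun y => f (Fin.cons 1 y)) x < Qc (fun y => f (Fin.cons 1 y)) x + ε by linarith)
  have h := Qc_le hc (Fin.cons t x) ((1 - s) • (Fin.cons 0 y0 : Fin (N+1) → ℝ) + s • (Fin.cons 1 y1 : Fin (N+1) → ℝ))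
  have hcv := hf.2 (Set.mem_univ (Fin.cons 0 y0 : Fin (N+1) → ℝ))
    (Set.mem_univ (Fin.cons 1 y1 : Fin (N+1) → ℝ)) (sub_nonneg.2 hs1) hs (by ring)
  have hsum : ∑ i, (x i - ((1 - s) * y0 i + s * y1 i))^2 ≤
      (1 - s) * ∑ i, (x i - y0 i)^2 + s * ∑ i, (x i - y1 i)^2 := by
    rw [Finset.mul_sum, Finset.mul_sum, ← Finset.sum_add_distrib]
    refine Finset.sum_le_sum fun i _ => ?_
    nlinarith [mul_nonneg (mul_nonneg hs (sub_nonneg.2 hs1)) (sq_nonneg (y0 i - y1 i))]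
  simp only [Fin.sum_univ_succ, Fin.cons_zero, Fin.cons_succ, Pi.add_apply, Pi.smul_apply,
    smul_eq_mul] at h hcv
  have : (1 - s) * (f (Fin.cons 0 y0) + (∑ i, (x i - y0 i)^2) / 4) +
    s * (f (Fin.cons 1 y1) + (∑ i, (x i - y1 i)^2) / 4) ≤
    (1 - s) * (Qc (fun y => f (Fin.cons 0 y)) x + ε) +
    s * (Qc (fun y => f (Fin.cons 1 y)) x + ε) := by
    have := sub_nonneg.2 hs1
    gcongr
  ring_nf at h hcv hsum this ⊢
  linarith

/-- Maurey property (τ) for the discrete cube -/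
lemma maurey {p : ℝ} (hp0 : 0 ≤ p) (hp1 : p ≤ 1) {N : ℕ} : ∀ (f : (Fin N → ℝ) → ℝ) (c : ℝ),
    (∀ y, c ≤ f y) → ConvexOn ℝ Set.univ f →
    Ex p (fun a : Fin N → Bool => Real.exp (Qc f (bv ∘ a))) *
      Ex p (fun a : Fin N → Bool => Real.exp (- f (bv ∘ a))) ≤ 1 := by
  induction N with
  | zero =>
    intro f c hc hf
    have : ∀ x, Qc f x ≤ f x := fun x => by simpa using Qc_le hc x x
    calc _ ≤ Ex p (fun a : Fin 0 → Bool => Real.exp (f (bv ∘ a))) *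
            Ex p (fun a : Fin 0 → Bool => Real.exp (- f (bv ∘ a))) := by
          gcongr
          · exact (Ex_exp_pos hp0 hp1 _).le
          · exact Ex_mono hp0 hp1 fun a => Real.exp_le_exp.2 (this _)
      _ = 1 := by simp [Ex, ← Real.exp_add]
  | succ N ih =>
    intro f c hc hf
    set f0 : (Fin N → ℝ) → ℝ := fun y => f (Fin.cons 0 y) with hf0
    set f1 : (Fin N → ℝ) → ℝ := fun y => f (Fin.cons 1 y) with hf1
    have conv : ∀ t : ℝ, ConvexOn ℝ Set.univ (fun y : Fin N → ℝ => f (Fin.cons t y)) := by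
      intro t
      refine ⟨convex_univ, fun x _ y _ a b ha hb hab => ?_⟩
      have := hf.2 (Set.mem_univ (Fin.cons t x : Fin (N+1) → ℝ))
        (Set.mem_univ (Fin.cons t y : Fin (N+1) → ℝ)) ha hb hab
      convert this using 2
      ext i
      refine Fin.cases ?_ (fun i => ?_) i
      · simp [← add_mul, hab]
      · simp
    have i0 := ih f0 c (fun y => hc _) (conv 0)
    have i1 := ih f1 c (fun y => hc _) (conv 1)
    have A0 := Ex_exp_pos hp0 hp1 (fun a : Fin N → Bool => Qc f0 (bv ∘ a))
    have A1 := Ex_exp_pos hp0 hp1 (fun a : Fin N → Bool => Qc f1 (bv ∘ a))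
    obtain ⟨α, hα⟩ : ∃ α, Real.exp α = Ex p (fun a : Fin N → Bool => Real.exp (Qc f0 (bv ∘ a))) :=
      ⟨_, Real.exp_log A0⟩
    obtain ⟨β, hβ⟩ : ∃ α, Real.exp α = Ex p (fun a : Fin N → Bool => Real.exp (Qc f1 (bv ∘ a))) :=
      ⟨_, Real.exp_log A1⟩
    have b0 : Ex p (fun a : Fin N → Bool => Real.exp (- f0 (bv ∘ a))) ≤ Real.exp (-α) := by
      rw [← hα] at i0
      rw [Real.exp_neg, le_inv_comm₀ (Ex_exp_pos hp0 hp1 _) (Real.exp_pos _)]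
      rw [inv_eq_one_div, le_div_iff₀ (Ex_exp_pos hp0 hp1 _)]; exact i0
    have b1 : Ex p (fun a : Fin N → Bool => Real.exp (- f1 (bv ∘ a))) ≤ Real.exp (-β) := by
      rw [← hβ] at i1
      rw [Real.exp_neg, le_inv_comm₀ (Ex_exp_pos hp0 hp1 _) (Real.exp_pos _)]
      rw [inv_eq_one_div, le_div_iff₀ (Ex_exp_pos hp0 hp1 _)]; exact i1
    have hH : ∀ t s : ℝ, 0 ≤ s → s ≤ 1 →
        Ex p (fun a : Fin N → Bool => Real.exp (Qc f (Fin.cons t (bv ∘ a)))) ≤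
        Real.exp ((1 - s) * α + s * β + (t - s)^2 / 4) := by
      intro t s hs hs1
      rw [Real.exp_add, mul_comm]
      calc _ ≤ Ex p (fun a : Fin N → Bool => Real.exp ((t - s)^2 / 4) *
            Real.exp ((1 - s) * Qc f0 (bv ∘ a) + s * Qc f1 (bv ∘ a))) := by
              refine Ex_mono hp0 hp1 fun a => ?_
              rw [← Real.exp_add]
              apply Real.exp_le_exp.2
              have := Qc_step hc hf (bv ∘ a) t s hs hs1
              linarith
        _ ≤ _ := by
          rw [Ex_mul_left]
          gcongr
          exact Ex_holder hp0 hp1 _ _ α β s hs hs1 hα.ge hβ.ge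
    have c0 : ∀ a : Fin N → Bool, (bv ∘ (Fin.cons false a : Fin (N+1) → Bool)) = Fin.cons 0 (bv ∘ a) := by
      intro a; ext i; refine Fin.cases ?_ (fun i => ?_) i <;> simp [bv]
    have c1 : ∀ a : Fin N → Bool, (bv ∘ (Fin.cons true a : Fin (N+1) → Bool)) = Fin.cons 1 (bv ∘ a) := by
      intro a; ext i; refine Fin.cases ?_ (fun i => ?_) i <;> simp [bv]
    rw [Ex_succ, Ex_succ]
    simp only [c0, c1]
    rcases le_total α β with h | h
    · refine two_point_aux hp0 hp1
        (Ex_exp_pos hp0 hp1 _).le (Ex_exp_pos hp0 hp1 _).le h b0 b1 ?_ ?_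
      · simpa using hH 0 0 le_rfl zero_le_one
      · intro s hs hs1; exact hH 1 s hs hs1
    · have := two_point_aux (p := 1 - p) (by linarith) (by linarith)
        (Ex_exp_pos hp0 hp1 _).le (Ex_exp_pos hp0 hp1 _).le h b1 b0 (by simpa using hH 1 1 zero_le_one le_rfl)
        (H1 := Ex p (fun a : Fin N → Bool => Real.exp (Qc f (Fin.cons 0 (bv ∘ a))))) (by
          intro s hs hs1
          convert hH 0 (1 - s) (by linarith) (by linarith) using 2
          ring)
      rw [sub_sub_cancel] at this
      linarith


lemma concentration_fin {p : ℝ} (hp0 : 0 ≤ p) (hp1 : p ≤ 1) {N : ℕ} (F : (Fin N → ℝ) → ℝ)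
    (hF0 : ∀ x, 0 ≤ F x) (hF : ConvexOn ℝ Set.univ F)
    (hL : ∀ x y, F x ≤ F y + Real.sqrt (∑ i, (x i - y i)^2)) (m s : ℝ) (hs : 0 ≤ s) :
    Ex p (fun a : Fin N → Bool => if F (bv ∘ a) ≤ m then 1 else 0) *
      Ex p (fun a : Fin N → Bool => if m + s ≤ F (bv ∘ a) then 1 else 0) ≤
        Real.exp (-(s^2/4)) := by
  set l := s / 2 with hl
  have hl0 : 0 ≤ l := by positivity
  have hm := maurey hp0 hp1 (fun x => l * F x) 0 (fun y => mul_nonneg hl0 (hF0 y))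
    (by simpa using hF.smul hl0)
  have hQ : ∀ x, l * F x - l^2 ≤ Qc (fun x => l * F x) x := by
    intro x
    refine le_ciInf fun y => ?_
    have h1 := hL x y
    have h0 : 0 ≤ (∑ i, (x i - y i)^2) := Finset.sum_nonneg fun _ _ => sq_nonneg _
    have h2 := Real.sq_sqrt h0
    nlinarith [sq_nonneg (Real.sqrt (∑ i, (x i - y i)^2) / 2 - l), mul_le_mul_of_nonneg_left h1 hl0]
  have A1 : Real.exp (l * (m + s) - l^2) *
      Ex p (fun a : Fin N → Bool => if m + s ≤ F (bv ∘ a) then 1 else 0) ≤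
      Ex p (fun a : Fin N → Bool => Real.exp (Qc (fun x => l * F x) (bv ∘ a))) := by
    rw [← Ex_mul_left]
    refine Ex_mono hp0 hp1 fun a => ?_
    split_ifs with h
    · rw [mul_one]; apply Real.exp_le_exp.2
      have := hQ (bv ∘ a)
      nlinarith [mul_le_mul_of_nonneg_left h hl0]
    · simp; positivity
  have A2 : Real.exp (- (l * m)) *
      Ex p (fun a : Fin N → Bool => if F (bv ∘ a) ≤ m then 1 else 0) ≤
      Ex p (fun a : Fin N → Bool => Real.exp (-(l * F (bv ∘ a)))) := by
    rw [← Ex_mul_left]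
    refine Ex_mono hp0 hp1 fun a => ?_
    split_ifs with h
    · rw [mul_one]; apply Real.exp_le_exp.2
      nlinarith [mul_le_mul_of_nonneg_left h hl0]
    · simp; positivity
  have A3 := (mul_le_mul A1 A2 (mul_nonneg (Real.exp_pos _).le (Ex_nonneg hp0 hp1 fun a => by split_ifs <;> norm_num))
    (Ex_exp_pos hp0 hp1 _).le).trans hm
  have e : Real.exp (l * (m + s) - l^2) * Real.exp (-(l * m)) * Real.exp (-(s^2/4)) = 1 := by
    rw [← Real.exp_add, ← Real.exp_add, hl, Real.exp_eq_one_iff]; ring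
  set P1 := Ex p (fun a : Fin N → Bool => if F (bv ∘ a) ≤ m then (1:ℝ) else 0)
  set P2 := Ex p (fun a : Fin N → Bool => if m + s ≤ F (bv ∘ a) then (1:ℝ) else 0)
  have hh := mul_le_mul_of_nonneg_right A3 (Real.exp_pos (-(s^2/4))).le
  calc P1 * P2 = (Real.exp (l * (m + s) - l^2) * Real.exp (-(l * m)) * Real.exp (-(s^2/4))) * (P1 * P2) := by rw [e, one_mul]
    _ ≤ 1 * Real.exp (-(s^2/4)) := by refine le_trans (le_of_eq ?_) hh; ring
    _ = _ := one_mul _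

lemma concentration {p : ℝ} (hp0 : 0 ≤ p) (hp1 : p ≤ 1) {ι : Type*} [Fintype ι] [DecidableEq ι]
    (F : (ι → ℝ) → ℝ)
    (hF0 : ∀ x, 0 ≤ F x) (hF : ConvexOn ℝ Set.univ F)
    (hL : ∀ x y, F x ≤ F y + Real.sqrt (∑ i, (x i - y i)^2)) (m s : ℝ) (hs : 0 ≤ s) :
    Ex p (fun a : ι → Bool => if F (bv ∘ a) ≤ m then 1 else 0) *
      Ex p (fun a : ι → Bool => if m + s ≤ F (bv ∘ a) then 1 else 0) ≤
        Real.exp (-(s^2/4)) := by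
  have e := Fintype.equivFin ι
  rw [Ex_equiv e, Ex_equiv e]
  have := concentration_fin hp0 hp1 (fun x : Fin (Fintype.card ι) → ℝ => F (x ∘ e))
    (fun x => hF0 _) ⟨convex_univ, fun x _ y _ a b ha hb hab =>
      hF.2 (Set.mem_univ (x ∘ e)) (Set.mem_univ (y ∘ e)) ha hb hab⟩
    (fun x y => by
      refine (hL (x ∘ e) (y ∘ e)).trans_eq ?_
      congr 2
      exact e.sum_comp (fun i => (x i - y i)^2)) m s hs
  exact this

lemma eNorm_eq {n : ℕ} (x : Fin n → ℝ) : eNorm x = ‖WithLp.toLp 2 x‖ := by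
  simp [eNorm, EuclideanSpace.norm_eq]

lemma matNorm_eq {n : ℕ} (A : Matrix (Fin n) (Fin n) ℝ) :
    matNorm A = ‖Matrix.toEuclideanCLM (n := Fin n) (𝕜 := ℝ) A‖ := by
  rw [matNorm, ← ContinuousLinearMap.sSup_unitClosedBall_eq_norm]
  congr 1
  ext r
  constructor
  · rintro ⟨x, hx, rfl⟩
    refine ⟨WithLp.toLp 2 x, by simpa [eNorm_eq] using hx, ?_⟩
    simp [eNorm_eq]
  · rintro ⟨x, hx, rfl⟩
    refine ⟨WithLp.ofLp x, by simpa [eNorm_eq] using hx, ?_⟩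
    rw [eNorm_eq]; rfl

lemma matNorm_nonneg {n : ℕ} (A : Matrix (Fin n) (Fin n) ℝ) : 0 ≤ matNorm A := by
  rw [matNorm_eq]; exact norm_nonneg _

lemma eNorm_nonneg {n : ℕ} (x : Fin n → ℝ) : 0 ≤ eNorm x := Real.sqrt_nonneg _

lemma eNorm_mulVec_le {n : ℕ} (A : Matrix (Fin n) (Fin n) ℝ) (x : Fin n → ℝ) :
    eNorm (A.mulVec x) ≤ matNorm A * eNorm x := by
  rw [matNorm_eq, eNorm_eq, eNorm_eq]
  exact (Matrix.toEuclideanCLM (n := Fin n) (𝕜 := ℝ) A).le_opNorm (WithLp.toLp 2 x)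

lemma matNorm_le_of {n : ℕ} (A : Matrix (Fin n) (Fin n) ℝ) (c : ℝ) (hc : 0 ≤ c)
    (h : ∀ x, eNorm (A.mulVec x) ≤ c * eNorm x) : matNorm A ≤ c := by
  rw [matNorm_eq]
  refine ContinuousLinearMap.opNorm_le_bound _ hc fun x => ?_
  have := h (WithLp.ofLp x)
  rw [eNorm_eq, eNorm_eq] at this
  exact this

lemma matNorm_add_le {n : ℕ} (A B : Matrix (Fin n) (Fin n) ℝ) :
    matNorm (A + B) ≤ matNorm A + matNorm B := by
  simp only [matNorm_eq, map_add]; exact norm_add_le _ _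

lemma matNorm_smul {n : ℕ} (c : ℝ) (A : Matrix (Fin n) (Fin n) ℝ) :
    matNorm (c • A) = |c| * matNorm A := by
  simp only [matNorm_eq, map_smul]; rw [norm_smul]; rfl

lemma matNorm_le_frob {n : ℕ} (A : Matrix (Fin n) (Fin n) ℝ) :
    matNorm A ≤ Real.sqrt (∑ ij : Fin n × Fin n, (A ij.1 ij.2)^2) := by
  refine matNorm_le_of _ _ (Real.sqrt_nonneg _) fun x => ?_
  rw [eNorm, eNorm, ← Real.sqrt_mul (Finset.sum_nonneg fun _ _ => sq_nonneg _)]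
  apply Real.sqrt_le_sqrt
  rw [Fintype.sum_prod_type, Finset.sum_mul]
  refine Finset.sum_le_sum fun i _ => ?_
  exact Finset.sum_mul_sq_le_sq_mul_sq Finset.univ (fun j => A i j) x

/-- matrix from a function on pairs -/
def mkM {n : ℕ} (x : Fin n × Fin n → ℝ) : Matrix (Fin n) (Fin n) ℝ := Matrix.of fun i j => x (i, j)

lemma conc_matrix {n : ℕ} {p : ℝ} (hp0 : 0 ≤ p) (hp1 : p ≤ 1) (m s : ℝ) (hs : 0 ≤ s) :
    Ex p (fun a : Fin n × Fin n → Bool =>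
        if matNorm (mkM (bv ∘ a) - Matrix.of fun _ _ => p) ≤ m then 1 else 0) *
      Ex p (fun a : Fin n × Fin n → Bool =>
        if m + s ≤ matNorm (mkM (bv ∘ a) - Matrix.of fun _ _ => p) then 1 else 0) ≤
        Real.exp (-(s^2/4)) := by
  refine concentration hp0 hp1 (fun x => matNorm (mkM x - Matrix.of fun _ _ => p))
    (fun x => matNorm_nonneg _) ⟨convex_univ, fun x _ y _ a b ha hb hab => ?_⟩ (fun x y => ?_) m s hs
  · have : mkM (a • x + b • y) - (Matrix.of fun _ _ => p) =
      a • (mkM x - Matrix.of fun _ _ => p) + b • (mkM y - Matrix.of fun _ _ => p) := by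
      ext i j
      have : p = a * p + b * p := by rw [← add_mul, hab, one_mul]
      simp [mkM]; linarith
    simp only [this]
    refine (matNorm_add_le _ _).trans ?_
    rw [matNorm_smul, matNorm_smul, abs_of_nonneg ha, abs_of_nonneg hb]
    rfl
  · have : mkM x - (Matrix.of fun _ _ => p) = (mkM y - Matrix.of fun _ _ => p) + (mkM (x - y)) := by
      ext i j; simp [mkM]
    rw [this]
    refine (matNorm_add_le _ _).trans ?_
    gcongr
    refine (matNorm_le_frob _).trans_eq ?_
    simp [mkM]

lemma matNorm_const_le {n : ℕ} {p : ℝ} (hp : 0 ≤ p) :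
    matNorm (Matrix.of fun _ _ : Fin n => p) ≤ p * n := by
  refine (matNorm_le_frob _).trans_eq ?_
  rw [Real.sqrt_eq_iff_mul_self_eq (Finset.sum_nonneg fun _ _ => sq_nonneg _) (by positivity)]
  simp; ring


lemma hoeff (θ : ℝ) : 1/3 * Real.exp (θ * 2) + (1 - 1/3) * Real.exp (θ * (-1)) ≤ Real.exp (9 / 8 * θ^2) := by
  let μ : Measure ℝ := ENNReal.ofReal (1/3) • Measure.dirac 2 + ENNReal.ofReal (2/3) • Measure.dirac (-1)
  have hintg : ∀ f : ℝ → ℝ, ∫ x, f x ∂μ = 1/3 * f 2 + 2/3 * f (-1) := by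
    intro f
    rw [integral_add_measure, integral_smul_measure, integral_smul_measure]
    · simp; norm_num
    · exact (integrable_dirac (by simp)).smul_measure (by simp)
    · exact (integrable_dirac (by simp)).smul_measure (by simp)
  have : IsProbabilityMeasure μ := by
    constructor
    simp only [μ, Measure.add_apply, Measure.smul_apply, measure_univ, smul_eq_mul, mul_one]
    rw [← ENNReal.ofReal_add (by norm_num) (by norm_num)]; norm_num
  have h := ProbabilityTheory.hasSubgaussianMGF_of_mem_Icc_of_integral_eq_zero (μ := μ) (X := id)
    (a := -1) (b := 2) aemeasurable_id (by
      simp only [μ]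
      rw [Filter.Eventually, MeasureTheory.mem_ae_iff]
      simp
      norm_num) (by rw [hintg]; norm_num)
  have h2 := h.mgf_le θ
  rw [ProbabilityTheory.mgf, hintg] at h2
  simp only [id] at h2
  have e : ((((‖(2:ℝ) - -1‖₊ / 2) ^ 2 : NNReal)) : ℝ) = 9/4 := by
    simp; norm_num
  rw [e] at h2
  convert h2 using 2 <;> ring

lemma exists_net (r : ℕ) : ∃ S : Finset (EuclideanSpace ℝ (Fin r)), S.card ≤ 5^r ∧
    (∀ c ∈ S, ‖c‖ ≤ 1) ∧ ∀ x, ‖x‖ ≤ 1 → ∃ c ∈ S, ‖x - c‖ ≤ 1/2 := by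
  classical
  let P : Finset (EuclideanSpace ℝ (Fin r)) → Prop := fun S => (∀ c ∈ S, ‖c‖ ≤ 1) ∧
    ∀ c ∈ S, ∀ d ∈ S, c ≠ d → 1/2 ≤ ‖c - d‖
  have hP : ∀ S, P S → S.card ≤ 5^r := by
    intro S hS
    have inj : Function.Injective (fun x : EuclideanSpace ℝ (Fin r) => (2:ℝ) • x) :=
      smul_right_injective _ (by norm_num)
    have := Besicovitch.card_le_of_separated (S.image (fun x => (2:ℝ) • x)) (by
      intro c hc
      obtain ⟨x, hx, rfl⟩ := Finset.mem_image.1 hc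
      rw [norm_smul]; have := hS.1 x hx; norm_num; linarith) (by
      intro c hc d hd hcd
      obtain ⟨x, hx, rfl⟩ := Finset.mem_image.1 hc
      obtain ⟨y, hy, rfl⟩ := Finset.mem_image.1 hd
      rw [← smul_sub, norm_smul]
      have := hS.2 x hx y hy (fun h => hcd (by rw [h])); norm_num; linarith)
    rwa [Finset.card_image_of_injective _ inj, finrank_euclideanSpace_fin] at this
  let Q : ℕ → Prop := fun k => ∃ S, P S ∧ S.card = k
  have h0 : Q 0 := ⟨∅, by simp [P], rfl⟩
  obtain ⟨S, hS, hSc⟩ : Q (Nat.findGreatest Q (5^r)) := Nat.findGreatest_spec (Nat.zero_le _) h0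
  refine ⟨S, hP S hS, hS.1, fun x hx => ?_⟩
  by_contra! hcon
  have hxS : x ∉ S := fun h => by have := hcon x h; norm_num at this
  have hP' : P (insert x S) := by
    constructor
    · intro c hc
      rcases Finset.mem_insert.1 hc with rfl | h
      · exact hx
      · exact hS.1 c h
    · intro c hc d hd hcd
      rcases Finset.mem_insert.1 hc with rfl | h <;> rcases Finset.mem_insert.1 hd with rfl | h'
      · exact absurd rfl hcd
      · exact (hcon d h').le
      · rw [norm_sub_rev]; exact (hcon c h).le
      · exact hS.2 c h d h' hcd
  have hc := hP _ hP'
  have := Nat.le_findGreatest hc (P := Q) ⟨_, hP', rfl⟩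
  rw [Finset.card_insert_of_notMem hxS] at this
  omega

lemma net_norm {r : ℕ} (S : Finset (EuclideanSpace ℝ (Fin r))) (hS : ∀ x, ‖x‖ ≤ 1 → ∃ c ∈ S, ‖x - c‖ ≤ 1/2)
    (A : EuclideanSpace ℝ (Fin r) →L[ℝ] EuclideanSpace ℝ (Fin r)) :
    ∃ x ∈ S, ∃ y ∈ S, ‖A‖ ≤ 4 * inner ℝ y (A x) := by
  have hne : S.Nonempty := by
    obtain ⟨c, hc, _⟩ := hS 0 (by simp)
    exact ⟨c, hc⟩
  obtain ⟨x, hx, hxm⟩ := S.exists_max_image (fun x => ‖A x‖) hne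
  obtain ⟨y, hy, hym⟩ := S.exists_max_image (fun y => inner ℝ y (A x)) hne
  refine ⟨x, hx, y, hy, ?_⟩
  have h1 : ‖A‖ ≤ ‖A x‖ + ‖A‖ / 2 := by
    refine A.opNorm_le_of_unit_norm (by positivity) fun z hz => ?_
    obtain ⟨c, hc, hzc⟩ := hS z hz.le
    have : A z = A c + A (z - c) := by simp
    rw [this]
    refine (norm_add_le _ _).trans ?_
    have := hxm c hc
    have := A.le_opNorm (z - c)
    have := mul_le_mul_of_nonneg_left hzc (norm_nonneg A)
    linarith
  have h2 : ‖A x‖ ≤ inner ℝ y (A x) + ‖A x‖ / 2 := by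
    set v := A x with hv
    by_cases hv0 : v = 0
    · simp [hv0]
    have hvn : ‖v‖ ≠ 0 := norm_ne_zero_iff.2 hv0
    obtain ⟨c, hc, hzc⟩ := hS (‖v‖⁻¹ • v) (by rw [norm_smul, norm_inv, norm_norm, inv_mul_cancel₀ hvn])
    have e1 : inner ℝ (‖v‖⁻¹ • v) v = ‖v‖ := by
      rw [real_inner_smul_left, real_inner_self_eq_norm_sq]; field_simp
    have e2 : inner ℝ (‖v‖⁻¹ • v) v = inner ℝ c v + inner ℝ (‖v‖⁻¹ • v - c) v := by
      rw [← inner_add_left]; simp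
    have := real_inner_le_norm (‖v‖⁻¹ • v - c) v
    have := mul_le_mul_of_nonneg_right hzc (norm_nonneg v)
    have := hym c hc
    linarith
  linarith

/-- values 2 / -1 -/
noncomputable def yv (b : Bool) : ℝ := if b then 2 else -1

lemma le_dsum {α : Type*} (S : Finset α) (f : α → α → ℝ) (hf : ∀ x y, 0 ≤ f x y) {x y : α}
    (hx : x ∈ S) (hy : y ∈ S) : f x y ≤ ∑ x ∈ S, ∑ y ∈ S, f x y :=
  (Finset.single_le_sum (f := fun y => f x y) (fun y _ => hf x y) hy).trans
    (Finset.single_le_sum (f := fun x => ∑ y ∈ S, f x y)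
      (fun x _ => Finset.sum_nonneg fun y _ => hf x y) hx)

lemma Y_exp (r : ℕ) (l : ℝ) (hl : 0 ≤ l) :
    Ex (1/3) (fun a : Fin r × Fin r → Bool => Real.exp (l * matNorm (mkM (yv ∘ a)))) ≤
      25^r * Real.exp (18 * l^2) := by
  obtain ⟨S, hSc, hS1, hS⟩ := exists_net r
  have h0 : (0:ℝ) ≤ 1/3 := by norm_num
  have h1 : (1:ℝ)/3 ≤ 1 := by norm_num
  have key : ∀ a : Fin r × Fin r → Bool, Real.exp (l * matNorm (mkM (yv ∘ a))) ≤
      ∑ x ∈ S, ∑ y ∈ S, ∏ e : Fin r × Fin r, Real.exp (4 * l * (y e.1 * x e.2) * yv (a e)) := by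
    intro a
    obtain ⟨x, hx, y, hy, h⟩ := net_norm S hS (Matrix.toEuclideanCLM (n := Fin r) (𝕜 := ℝ) (mkM (yv ∘ a)))
    rw [← matNorm_eq, Matrix.inner_toEuclideanCLM] at h
    have e : Real.exp (l * matNorm (mkM (yv ∘ a))) ≤
        ∏ e : Fin r × Fin r, Real.exp (4 * l * (y e.1 * x e.2) * yv (a e)) := by
      rw [← Real.exp_sum]
      apply Real.exp_le_exp.2
      refine (mul_le_mul_of_nonneg_left h hl).trans_eq ?_
      simp only [dotProduct, Matrix.mulVec, mkM, Matrix.of_apply, Finset.mul_sum, Function.comp,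
        Fintype.sum_prod_type]
      exact Finset.sum_congr rfl fun i _ => Finset.sum_congr rfl fun j _ => by ring
    refine e.trans ?_
    exact le_dsum S (fun x y => ∏ e : Fin r × Fin r, Real.exp (4 * l * (y e.1 * x e.2) * yv (a e)))
      (fun x y => Finset.prod_nonneg fun _ _ => (Real.exp_pos _).le) hx hy
  refine (Ex_mono h0 h1 key).trans ?_
  rw [Ex_sum]
  have each : ∀ x ∈ S, ∀ y ∈ S, Ex (1/3) (fun a : Fin r × Fin r → Bool =>
      ∏ e : Fin r × Fin r, Real.exp (4 * l * (y e.1 * x e.2) * yv (a e))) ≤ Real.exp (18 * l^2) := by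
    intro x hx y hy
    rw [Ex_prod (fun (e : Fin r × Fin r) b => Real.exp (4 * l * (y e.1 * x e.2) * yv b))]
    have : ∀ e : Fin r × Fin r, 1/3 * Real.exp (4 * l * (y e.1 * x e.2) * yv true) +
        (1 - 1/3) * Real.exp (4 * l * (y e.1 * x e.2) * yv false) ≤
        Real.exp (9/8 * (4 * l * (y e.1 * x e.2))^2) := fun e => by
      simpa [yv] using hoeff (4 * l * (y e.1 * x e.2))
    refine (Finset.prod_le_prod (fun e _ => by positivity) (fun e _ => this e)).trans ?_
    rw [← Real.exp_sum]
    apply Real.exp_le_exp.2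
    have e1 : ∑ e : Fin r × Fin r, 9/8 * (4 * l * (y e.1 * x e.2))^2 =
        18 * l^2 * (‖y‖^2 * ‖x‖^2) := by
      rw [EuclideanSpace.norm_sq_eq, EuclideanSpace.norm_sq_eq, Finset.sum_mul_sum,
        Fintype.sum_prod_type]
      simp only [Finset.mul_sum, Real.norm_eq_abs, sq_abs]
      exact Finset.sum_congr rfl fun i _ => Finset.sum_congr rfl fun j _ => by ring
    rw [e1]
    have hx1 := hS1 x hx
    have hy1 := hS1 y hy
    have : ‖y‖^2 * ‖x‖^2 ≤ 1 := by
      have := pow_le_one₀ (norm_nonneg x) hx1 (n := 2)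
      have := pow_le_one₀ (norm_nonneg y) hy1 (n := 2)
      exact mul_le_one₀ this (by positivity) (by assumption)
    have := mul_le_mul_of_nonneg_left this (show 0 ≤ 18 * l^2 by positivity)
    linarith
  calc _ ≤ ∑ x ∈ S, ∑ y ∈ S, Real.exp (18 * l^2) := by
        refine Finset.sum_le_sum fun x hx => ?_
        rw [Ex_sum]
        exact Finset.sum_le_sum fun y hy => each x hx y hy
    _ = (S.card : ℝ) * S.card * Real.exp (18 * l^2) := by simp; ring
    _ ≤ (5^r : ℝ) * 5^r * Real.exp (18 * l^2) := by
        have : (S.card : ℝ) ≤ 5^r := by exact_mod_cast hSc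
        gcongr
    _ = _ := by rw [← mul_pow]; norm_num

lemma Y_moment (k : ℕ) (hk : 0 < k) :
    Ex (1/3) (fun a : Fin (2*k) × Fin (2*k) → Bool => matNorm (mkM (yv ∘ a)) ^ (2*k)) ≤
      2 * (576 * k : ℝ)^k := by
  have h0 : (0:ℝ) ≤ 1/3 := by norm_num
  have h1 : (1:ℝ)/3 ≤ 1 := by norm_num
  have kpos : (0:ℝ) < k := by exact_mod_cast hk
  set q := Real.sqrt k with hq
  have hq0 : 0 < q := Real.sqrt_pos.2 kpos
  have hq2 : q^2 = k := Real.sq_sqrt kpos.le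
  have hY := Y_exp (2*k) (0.6 * q) (by positivity)
  have key : ∀ a : Fin (2*k) × Fin (2*k) → Bool, matNorm (mkM (yv ∘ a)) ^ (2*k) ≤
      (24 * q)^(2*k) * (1 + Real.exp (-(14.4 * k)) * Real.exp (0.6 * q * matNorm (mkM (yv ∘ a)))) := by
    intro a
    have hx := matNorm_nonneg (mkM (yv ∘ a))
    set x := matNorm (mkM (yv ∘ a))
    by_cases h : x ≤ 24 * q
    · calc x^(2*k) ≤ (24*q)^(2*k) * (1 + 0) := by simp; gcongr
        _ ≤ _ := by gcongr; positivity
    · push Not at h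
      have e1 : x ≤ 24 * q * Real.exp ((x - 24*q)/(24 * q)) := by
        have := Real.add_one_le_exp ((x - 24*q)/(24 * q))
        calc x = 24 * q * ((x - 24*q)/(24 * q) + 1) := by field_simp; ring
          _ ≤ _ := by gcongr
      calc x^(2*k) ≤ (24 * q * Real.exp ((x - 24*q)/(24 * q)))^(2*k) := by gcongr
        _ = (24 * q)^(2*k) * Real.exp ((2*k : ℕ) * ((x - 24*q)/(24 * q))) := by
            rw [mul_pow, Real.exp_nat_mul]
        _ ≤ (24 * q)^(2*k) * (0 + Real.exp (-(14.4 * k)) * Real.exp (0.6 * q * x)) := by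
            rw [zero_add, ← Real.exp_add]
            gcongr
            push_cast
            rw [← hq2]
            have : 2 * q^2 * ((x - 24*q)/(24 * q)) = q * (x - 24 * q) / 12 := by field_simp; ring
            rw [this]
            nlinarith
        _ ≤ _ := by gcongr; norm_num
  refine (Ex_mono h0 h1 key).trans ?_
  rw [Ex_mul_left, Ex_add, Ex_mul_left, Ex_one]
  have e25 : (25:ℝ)^(2*k) ≤ Real.exp (7 * k) := by
    rw [pow_mul, mul_comm, Real.exp_nat_mul]
    gcongr
    have : (2.7:ℝ)^7 ≤ Real.exp 7 := by
      have h := Real.exp_one_gt_d9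
      rw [show (7:ℝ) = (7:ℕ) * 1 by norm_num, Real.exp_nat_mul]
      gcongr
      linarith
    norm_num at this ⊢; linarith
  have e2 : Real.exp (-(14.4 * k)) * (25^(2*k) * Real.exp (18 * (0.6 * q)^2)) ≤ 1 := by
    calc _ ≤ Real.exp (-(14.4 * k)) * (Real.exp (7 * k) * Real.exp (18 * (0.6 * q)^2)) := by gcongr
      _ ≤ 1 := by
        rw [← Real.exp_add, ← Real.exp_add]
        apply Real.exp_le_one_iff.2
        rw [mul_pow, hq2]; norm_num; linarith
  have e3 : (24 * q)^(2*k) = (576 * k : ℝ)^k := by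
    rw [pow_mul, mul_pow, hq2]; norm_num
  rw [e3, mul_comm (2:ℝ)]
  gcongr
  have := mul_le_mul_of_nonneg_left hY (Real.exp_pos (-(14.4 * k))).le
  linarith


lemma pow_entry {n : ℕ} (M : Matrix (Fin n) (Fin n) ℝ) (k : ℕ) : ∀ u v, (M^k) u v =
    ∑ i : Fin (k+1) → Fin n, if i 0 = u ∧ i (Fin.last k) = v then
      ∏ l : Fin k, M (i l.castSucc) (i l.succ) else 0 := by
  induction k with
  | zero =>
    intro u v
    rw [← (Equiv.funUnique (Fin 1) (Fin n)).symm.sum_comp]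
    simp [Matrix.one_apply, Finset.sum_ite, Finset.filter_and, Finset.filter_eq']
    split_ifs with h <;> simp [h]
  | succ k ih =>
    intro u v
    rw [pow_succ', Matrix.mul_apply, ← (Fin.consEquiv (fun _ => Fin n)).sum_comp, Fintype.sum_prod_type]
    simp only [ih, Fin.consEquiv, Equiv.coe_fn_mk, Fin.cons_zero, Fin.prod_univ_succ]
    simp only [← Fin.succ_last, Fin.cons_succ, Fin.castSucc_zero, Fin.cons_zero, ← Fin.succ_castSucc]
    simp_rw [Finset.mul_sum]
    rw [Finset.sum_comm]
    conv_rhs => rw [Finset.sum_comm]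
    refine Finset.sum_congr rfl fun i _ => ?_
    have e1 : ∀ f : Fin n → ℝ, (∀ b, b ≠ i 0 → f b = 0) → ∑ b, f b = f (i 0) := fun f hf =>
      Finset.sum_eq_single _ (fun b _ hb => hf b hb) (by simp)
    have e2 : ∀ f : Fin n → ℝ, (∀ b, b ≠ u → f b = 0) → ∑ b, f b = f u := fun f hf =>
      Finset.sum_eq_single _ (fun b _ hb => hf b hb) (by simp)
    refine (e1 _ (by intro b hb; simp [hb.symm])).trans ((e2 _ (by intro b hb; simp [hb])).trans ?_).symm
    simp

/-- row index of a step -/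
def rix {k : ℕ} (s : Fin k × Bool) : Fin (k+1) := if s.2 then s.1.succ else s.1.castSucc

lemma trace_entry {n : ℕ} (A : Matrix (Fin n) (Fin n) ℝ) (k : ℕ) : ((A * A.transpose)^k).trace =
    ∑ i : Fin (k+1) → Fin n, ∑ j : Fin k → Fin n, if i 0 = i (Fin.last k) then
      ∏ s : Fin k × Bool, A (i (rix s)) (j s.1) else 0 := by
  simp only [Matrix.trace, Matrix.diag, pow_entry]
  rw [Finset.sum_comm]
  refine Finset.sum_congr rfl fun i _ => ?_
  have h1 : ∏ l : Fin k, (A * A.transpose) (i l.castSucc) (i l.succ) =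
      ∑ j : Fin k → Fin n, ∏ s : Fin k × Bool, A (i (rix s)) (j s.1) := by
    simp only [Matrix.mul_apply, Matrix.transpose_apply]
    rw [Finset.prod_univ_sum]
    simp only [Fintype.piFinset_univ]
    refine Finset.sum_congr rfl fun j _ => ?_
    rw [Fintype.prod_prod_type]
    refine Finset.prod_congr rfl fun l _ => ?_
    simp [rix, mul_comm]
  rw [Finset.sum_eq_single (i 0) (by intro b _ hb; simp [hb.symm]) (by simp), h1]
  by_cases h : i 0 = i (Fin.last k)
  · simp [h]
  · simp [h, Ne.symm h]

/-- moments -/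
noncomputable def mom (p : ℝ) (v : Bool → ℝ) (m : ℕ) : ℝ := p * v true ^ m + (1 - p) * v false ^ m

lemma Ex_walk {p : ℝ} {ι σ : Type*} [Fintype ι] [DecidableEq ι] [Fintype σ] (v : Bool → ℝ)
    (e : σ → ι) : Ex p (fun a : ι → Bool => ∏ s, v (a (e s))) =
      ∏ c, mom p v (Finset.univ.filter (fun s => e s = c)).card := by
  refine Eq.trans ?_ (Ex_prod (p := p) (fun c b => v b ^ (Finset.univ.filter (fun s => e s = c)).card))
  congr 1
  ext a
  rw [← Finset.prod_fiberwise' Finset.univ e (fun c => v (a c))]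
  simp

/-- every value is attained at least twice -/
def good {σ ι : Type*} (e : σ → ι) : Prop := ∀ s, ∃ s', s' ≠ s ∧ e s' = e s

lemma card_ne_one_of_good {σ ι : Type*} [Fintype σ] [DecidableEq ι] {e : σ → ι} (h : good e) (c : ι) :
    (Finset.univ.filter (fun s => e s = c)).card ≠ 1 := by
  intro h1
  obtain ⟨s, hs⟩ := Finset.card_eq_one.1 h1
  have : e s = c := by
    have : s ∈ Finset.univ.filter (fun s => e s = c) := by rw [hs]; simp
    simpa using this
  obtain ⟨s', hne, hs'⟩ := h s
  have : s' ∈ Finset.univ.filter (fun s => e s = c) := by simp [hs', this]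
  rw [hs] at this
  exact hne (by simpa using this)

lemma card_one_of_not_good {σ ι : Type*} [Fintype σ] [DecidableEq ι] {e : σ → ι} (h : ¬ good e) :
    ∃ c, (Finset.univ.filter (fun s => e s = c)).card = 1 := by
  simp only [good, not_forall, not_exists, not_and] at h
  obtain ⟨s, hs⟩ := h
  refine ⟨e s, Finset.card_eq_one.2 ⟨s, ?_⟩⟩
  ext s'
  simp only [Finset.mem_filter, Finset.mem_univ, true_and, Finset.mem_singleton]
  constructor
  · intro h; by_contra hne; exact hs s' hne h
  · rintro rfl; rfl

lemma momX_zero (p : ℝ) : mom p (fun b => bv b - p) 0 = 1 := by simp [mom]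
lemma momX_one (p : ℝ) : mom p (fun b => bv b - p) 1 = 0 := by simp [mom, bv]; ring
lemma momX_le {p : ℝ} (h0 : 0 ≤ p) (h1 : p ≤ 1) (m : ℕ) (hm : 2 ≤ m) :
    |mom p (fun b => bv b - p) m| ≤ p := by
  have e : mom p (fun b => bv b - p) m = p * (1 - p)^m + (1 - p) * (-p)^m := by simp [mom, bv]
  rw [e]
  have hq : 0 ≤ 1 - p := by linarith
  calc _ ≤ |p * (1 - p)^m| + |(1 - p) * (-p)^m| := abs_add_le _ _
    _ = p * (1-p)^m + (1-p) * p^m := by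
      rw [abs_mul, abs_mul, abs_pow, abs_pow, abs_neg, abs_of_nonneg h0, abs_of_nonneg hq]
    _ ≤ p * (1-p)^2 + (1-p) * p^2 := by
      have := pow_le_pow_of_le_one hq (by linarith) hm
      have := pow_le_pow_of_le_one h0 h1 hm
      gcongr
    _ ≤ p := by nlinarith [mul_nonneg h0 hq, mul_nonneg h0 h0]

lemma momY_pos (m : ℕ) (hm : m ≠ 1) : 1 ≤ mom (1/3) yv m := by
  have e : mom (1/3) yv m = (2^m + 2 * (-1)^m) / 3 := by simp [mom, yv]; ring
  rw [e]
  rcases Nat.lt_or_ge m 3 with h | h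
  · interval_cases m
    · norm_num
    · exact absurd rfl hm
    · norm_num
  · have h8 : (2:ℝ)^3 ≤ 2^m := pow_le_pow_right₀ (by norm_num) h
    rcases neg_one_pow_eq_or ℝ m with h' | h' <;> rw [h'] <;> norm_num at h8 ⊢ <;> linarith

lemma momY_one : mom (1/3) yv 1 = 0 := by simp [mom, yv]; norm_num

open Classical in
lemma prodX_le {p : ℝ} (h0 : 0 ≤ p) (h1 : p ≤ 1) {ι σ : Type*} [Fintype ι] [DecidableEq ι] [Fintype σ]
    (e : σ → ι) : ∏ c, mom p (fun b => bv b - p) (Finset.univ.filter (fun s => e s = c)).card ≤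
      if good e then p ^ (Finset.univ.image e).card else 0 := by
  split_ifs with h
  · refine (le_abs_self _).trans ?_
    rw [Finset.abs_prod]
    rw [← Finset.prod_subset (Finset.subset_univ (Finset.univ.image e))]
    · rw [← Finset.prod_const]
      refine Finset.prod_le_prod (fun _ _ => abs_nonneg _) fun c hc => momX_le h0 h1 _ ?_
      have := card_ne_one_of_good h c
      obtain ⟨s, _, hs⟩ := Finset.mem_image.1 hc
      have : 0 < (Finset.univ.filter (fun s => e s = c)).card :=
        Finset.card_pos.2 ⟨s, by simp [hs]⟩
      omega
    · intro c _ hc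
      have : (Finset.univ.filter (fun s => e s = c)).card = 0 := by
        rw [Finset.card_eq_zero, Finset.filter_eq_empty_iff]
        intro s _ hs
        exact hc (Finset.mem_image.2 ⟨s, Finset.mem_univ _, hs⟩)
      rw [this, momX_zero, abs_one]
  · obtain ⟨c, hc⟩ := card_one_of_not_good h
    exact (Finset.prod_eq_zero (Finset.mem_univ c) (by rw [hc, momX_one])).le

open Classical in
lemma prodY_ge {ι σ : Type*} [Fintype ι] [DecidableEq ι] [Fintype σ]
    (e : σ → ι) : (if good e then (1:ℝ) else 0) ≤
      ∏ c, mom (1/3) yv (Finset.univ.filter (fun s => e s = c)).card := by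
  split_ifs with h
  · refine (Finset.prod_const_one (s := (Finset.univ : Finset ι))).symm.le.trans ?_
    exact Finset.prod_le_prod (fun _ _ => zero_le_one) fun c _ => momY_pos _ (card_ne_one_of_good h c)
  · refine Finset.prod_nonneg fun c _ => ?_
    by_cases h1 : (Finset.univ.filter (fun s => e s = c)).card = 1
    · rw [h1, momY_one]
    · exact zero_le_one.trans (momY_pos _ h1)

lemma connected_aux {U V : Type*} [DecidableEq U] [DecidableEq V] (i : ℕ → U) (j : ℕ → V) (t : ℕ) :
    ∃ E : Finset (U × V), (∀ c ∈ E, ∃ l < t, c = (i l, j l) ∨ c = (i (l+1), j l)) ∧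
    (∀ c ∈ E, c.1 ∈ (Finset.range (t+1)).image i ∧ c.2 ∈ (Finset.range t).image j) ∧
    ((Finset.range (t+1)).image i).card + ((Finset.range t).image j).card ≤ E.card + 1 := by
  induction t with
  | zero => exact ⟨∅, by simp⟩
  | succ t ih =>
    obtain ⟨E, hE1, hE2, hE3⟩ := ih
    have r1 : (Finset.range (t+1+1)).image i = insert (i (t+1)) ((Finset.range (t+1)).image i) := by
      rw [Finset.range_add_one (n := t+1), Finset.image_insert]
    have r2 : (Finset.range (t+1)).image j = insert (j t) ((Finset.range t).image j) := by
      rw [Finset.range_add_one (n := t), Finset.image_insert]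
    rw [r1, r2]
    set I := (Finset.range (t+1)).image i with hI
    set J := (Finset.range t).image j with hJ
    have hit : i t ∈ I := Finset.mem_image.2 ⟨t, by simp, rfl⟩
    refine ⟨insert (i (t+1), j t) (insert (i t, j t) E), ?_, ?_, ?_⟩
    · intro c hc
      simp only [Finset.mem_insert] at hc
      rcases hc with rfl | rfl | hc
      · exact ⟨t, by omega, Or.inr rfl⟩
      · exact ⟨t, by omega, Or.inl rfl⟩
      · obtain ⟨l, hl, h⟩ := hE1 c hc
        exact ⟨l, by omega, h⟩
    · intro c hc
      simp only [Finset.mem_insert] at hc ⊢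
      rcases hc with rfl | rfl | hc
      · simp
      · simp [hit]
      · exact ⟨Or.inr (hE2 c hc).1, Or.inr (hE2 c hc).2⟩
    · have s1 : I.card + (insert (j t) J).card ≤ (insert (i t, j t) E).card + 1 := by
        by_cases h : j t ∈ J
        · rw [Finset.insert_eq_of_mem h]
          have := Finset.card_le_card (Finset.subset_insert (i t, j t) E)
          omega
        · have : (i t, j t) ∉ E := fun hc => h (hE2 _ hc).2
          rw [Finset.card_insert_of_notMem h, Finset.card_insert_of_notMem this]
          omega
      by_cases h : i (t+1) ∈ I
      · rw [Finset.insert_eq_of_mem h]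
        have := Finset.card_le_card (Finset.subset_insert (i (t+1), j t) (insert (i t, j t) E))
        omega
      · have : (i (t+1), j t) ∉ insert (i t, j t) E := by
          intro hc
          rcases Finset.mem_insert.1 hc with hc | hc
          · apply h
            have h5 := (Prod.mk.inj hc).1; rw [h5]; exact hit
          · exact h (hE2 _ hc).1
        rw [Finset.card_insert_of_notMem h, Finset.card_insert_of_notMem this]
        omega

lemma connected {U V : Type*} [DecidableEq U] [DecidableEq V] {k : ℕ} (hk : 0 < k)
    (i : Fin (k+1) → U) (j : Fin k → V) :
    (Finset.univ.image i).card + (Finset.univ.image j).card ≤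
      (Finset.univ.image (fun s : Fin k × Bool => (i (rix s), j s.1))).card + 1 := by
  have : NeZero k := ⟨hk.ne'⟩
  obtain ⟨E, hE1, -, hE3⟩ := connected_aux (fun l => i (Fin.ofNat (k+1) l)) (fun l => j (Fin.ofNat k l)) k
  have e1 : (Finset.range (k+1)).image (fun l => i (Fin.ofNat (k+1) l)) = Finset.univ.image i := by
    ext u
    simp only [Finset.mem_image, Finset.mem_range, Finset.mem_univ, true_and]
    constructor
    · rintro ⟨l, _, h⟩; exact ⟨_, h⟩
    · rintro ⟨l, h⟩; exact ⟨l, l.2, by rw [← h]; congr 1; ext; simp [Nat.mod_eq_of_lt l.2]⟩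
  have e2 : (Finset.range k).image (fun l => j (Fin.ofNat k l)) = Finset.univ.image j := by
    ext u
    simp only [Finset.mem_image, Finset.mem_range, Finset.mem_univ, true_and]
    constructor
    · rintro ⟨l, _, h⟩; exact ⟨_, h⟩
    · rintro ⟨l, h⟩; exact ⟨l, l.2, by rw [← h]; congr 1; ext; simp [Nat.mod_eq_of_lt l.2]⟩
  rw [e1, e2] at hE3
  refine hE3.trans (Nat.add_le_add_right (Finset.card_le_card ?_) 1)
  intro c hc
  obtain ⟨l, hl, h⟩ := hE1 c hc
  simp only [Finset.mem_image, Finset.mem_univ, true_and]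
  rcases h with rfl | rfl
  · refine ⟨(⟨l, hl⟩, false), ?_⟩
    simp only [rix]
    congr 1
    · congr 1; ext; simp [Nat.mod_eq_of_lt (show l < k + 1 by omega)]
    · congr 1; ext; simp [Nat.mod_eq_of_lt hl]
  · refine ⟨(⟨l, hl⟩, true), ?_⟩
    simp only [rix]
    congr 1
    · congr 1; ext; simp [Nat.mod_eq_of_lt (show l + 1 < k + 1 by omega)]
    · congr 1; ext; simp [Nat.mod_eq_of_lt hl]


open Classical in
lemma shape_card {m : ℕ} (n : ℕ) (s : Setoid (Fin m)) :
    (Finset.univ.filter (fun i : Fin m → Fin n => Setoid.ker i = s)).card =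
      n.descFactorial (Nat.card (Quotient s)) := by
  have : Fintype (Quotient s) := Fintype.ofFinite _
  have h := Fintype.card_embedding_eq (α := Quotient s) (β := Fin n)
  rw [Fintype.card_fin, ← Nat.card_eq_fintype_card (α := Quotient s)] at h
  rw [← h, ← Fintype.card_subtype]
  refine Fintype.card_congr ⟨fun i => ⟨Quotient.lift i.1 ?_, ?_⟩, fun f => ⟨fun l => f ⟦l⟧, ?_⟩, ?_, ?_⟩
  · intro a b hab
    have h2 := i.2
    rw [← h2] at hab
    exact hab
  · intro a b
    induction a using Quotient.inductionOn
    induction b using Quotient.inductionOn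
    intro hab
    apply Quotient.sound
    have h2 := i.2
    change s.r _ _
    rw [← h2]
    exact hab
  · ext a b
    simp only [Setoid.ker_def]
    rw [f.injective.eq_iff, Quotient.eq]
  · intro i; rfl
  · intro f
    ext a
    induction a using Quotient.inductionOn
    rfl

lemma image_card_ker {m : ℕ} {U : Type*} [DecidableEq U] (i : Fin m → U) :
    (Finset.univ.image i).card = Nat.card (Quotient (Setoid.ker i)) := by
  rw [Nat.card_congr (Setoid.quotientKerEquivRange i)]
  rw [Nat.card_coe_set_eq, ← Set.ncard_coe_finset]
  simp

lemma quot_card_le {m : ℕ} (s : Setoid (Fin m)) : Nat.card (Quotient s) ≤ m := by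
  have := Nat.card_le_card_of_surjective (Quotient.mk s) Quotient.mk_surjective
  simpa using this

lemma shape {m n r : ℕ} (hm : m ≤ r + 1) {p : ℝ} (hp : 0 ≤ p) (hnp : (n:ℝ) * p ≤ r + 1 - m)
    (g : Setoid (Fin m) → ℝ) (hg : ∀ s, 0 ≤ g s) :
    ∑ i : Fin m → Fin n, g (Setoid.ker i) * p ^ (Finset.univ.image i).card ≤
      ∑ i : Fin m → Fin r, g (Setoid.ker i) := by
  classical
  have : Finite (Setoid (Fin m)) :=
    Finite.of_injective (fun s : Setoid (Fin m) => s.r) (by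
      intro s t h; ext a b; exact iff_of_eq (congrFun (congrFun h a) b))
  have : Fintype (Setoid (Fin m)) := Fintype.ofFinite _
  rw [← Finset.sum_fiberwise Finset.univ (fun i : Fin m → Fin n => Setoid.ker i),
    ← Finset.sum_fiberwise Finset.univ (fun i : Fin m → Fin r => Setoid.ker i)]
  refine Finset.sum_le_sum fun s _ => ?_
  have e1 : ∑ i ∈ Finset.univ.filter (fun i : Fin m → Fin n => Setoid.ker i = s),
      g (Setoid.ker i) * p ^ (Finset.univ.image i).card =
      (n.descFactorial (Nat.card (Quotient s)) : ℝ) * (g s * p ^ Nat.card (Quotient s)) := by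
    rw [← shape_card, ← nsmul_eq_mul, ← Finset.sum_const]
    refine Finset.sum_congr rfl fun i hi => ?_
    rw [image_card_ker, (Finset.mem_filter.1 hi).2]
  have e2 : ∑ i ∈ Finset.univ.filter (fun i : Fin m → Fin r => Setoid.ker i = s),
      g (Setoid.ker i) = (r.descFactorial (Nat.card (Quotient s)) : ℝ) * g s := by
    rw [← shape_card, ← nsmul_eq_mul, ← Finset.sum_const]
    refine Finset.sum_congr rfl fun i hi => ?_
    rw [(Finset.mem_filter.1 hi).2]
  rw [e1, e2]
  set q := Nat.card (Quotient s) with hq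
  have hqm : q ≤ m := quot_card_le s
  have h1 : (n.descFactorial q : ℝ) ≤ (n:ℝ)^q := by exact_mod_cast Nat.descFactorial_le_pow n q
  have h2 : ((r + 1 - q : ℕ) : ℝ)^q ≤ (r.descFactorial q : ℝ) := by
    exact_mod_cast Nat.pow_sub_le_descFactorial r q
  have h3 : (n:ℝ) * p ≤ ((r + 1 - q : ℕ) : ℝ) := by
    rw [Nat.cast_sub (by omega)]
    have : (q:ℝ) ≤ m := by exact_mod_cast hqm
    push_cast; linarith
  calc _ ≤ (n:ℝ)^q * (g s * p^q) := by
        have := hg s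
        gcongr
    _ = (n * p)^q * g s := by rw [mul_pow]; ring
    _ ≤ _ := by
      refine mul_le_mul_of_nonneg_right (le_trans ?_ h2) (hg s)
      gcongr

/-- combined pattern -/
def patt {m k : ℕ} (s : Setoid (Fin (k+1))) (t : Setoid (Fin m)) (f : Fin k → Fin m) : Prop :=
  s.r 0 (Fin.last k) ∧ ∀ a : Fin k × Bool, ∃ b, b ≠ a ∧ s.r (rix b) (rix a) ∧ t.r (f b.1) (f a.1)

lemma patt_iff {k : ℕ} {U V : Type*} (i : Fin (k+1) → U) (j : Fin k → V) :
    patt (Setoid.ker i) (Setoid.ker j) id ↔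
      (i 0 = i (Fin.last k) ∧ good (fun s : Fin k × Bool => (i (rix s), j s.1))) := by
  simp only [patt, good, Prod.mk.injEq, id]
  rfl

open Classical in
lemma shape2 {k n : ℕ} {p : ℝ} (hp : 0 ≤ p) (hnp : (n:ℝ) * p ≤ k) :
    ∑ i : Fin (k+1) → Fin n, ∑ j : Fin k → Fin n,
      (if i 0 = i (Fin.last k) ∧ good (fun s : Fin k × Bool => (i (rix s), j s.1)) then (1:ℝ) else 0)
        * p ^ (Finset.univ.image i).card * p ^ (Finset.univ.image j).card ≤
    ∑ i : Fin (k+1) → Fin (2*k), ∑ j : Fin k → Fin (2*k),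
      (if i 0 = i (Fin.last k) ∧ good (fun s : Fin k × Bool => (i (rix s), j s.1)) then (1:ℝ) else 0) := by
  simp only [← patt_iff]
  calc _ = ∑ j : Fin k → Fin n, ∑ i : Fin (k+1) → Fin n,
      ((if patt (Setoid.ker i) (Setoid.ker j) id then (1:ℝ) else 0) * p ^ (Finset.univ.image j).card)
        * p ^ (Finset.univ.image i).card := by
        rw [Finset.sum_comm]
        exact Finset.sum_congr rfl fun j _ => Finset.sum_congr rfl fun i _ => by ring
    _ ≤ ∑ j : Fin k → Fin n, ∑ i : Fin (k+1) → Fin (2*k),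
      ((if patt (Setoid.ker i) (Setoid.ker j) id then (1:ℝ) else 0) * p ^ (Finset.univ.image j).card) := by
        refine Finset.sum_le_sum fun j _ => ?_
        refine shape (by omega) hp (by push_cast; linarith) (fun s => (if patt s (Setoid.ker j) id then (1:ℝ) else 0) * p ^ (Finset.univ.image j).card) ?_
        intro s
        have : (0:ℝ) ≤ if patt s (Setoid.ker j) id then (1:ℝ) else 0 := by split_ifs <;> norm_num
        positivity
    _ = ∑ i : Fin (k+1) → Fin (2*k), ∑ j : Fin k → Fin n,
      (if patt (Setoid.ker i) (Setoid.ker j) id then (1:ℝ) else 0) * p ^ (Finset.univ.image j).card :=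
        Finset.sum_comm
    _ ≤ _ := by
        refine Finset.sum_le_sum fun i _ => ?_
        refine shape (by omega) hp (by push_cast; linarith) (fun s => (if patt (Setoid.ker i) s id then (1:ℝ) else 0)) ?_
        intro s
        split_ifs <;> norm_num


open scoped Matrix.Norms.L2Operator in
lemma matNorm_eq' {n : ℕ} (A : Matrix (Fin n) (Fin n) ℝ) : matNorm A = ‖A‖ := by
  rw [matNorm_eq]; rfl

open scoped Matrix.Norms.L2Operator in
lemma trace_le {n : ℕ} (A : Matrix (Fin n) (Fin n) ℝ) (k : ℕ) :
    ((A * A.transpose)^k).trace ≤ n * matNorm A ^ (2*k) := by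
  rcases Nat.eq_zero_or_pos n with rfl | hn
  · simp [Matrix.trace]
  have hN : Nontrivial (Matrix (Fin n) (Fin n) ℝ) := by
    have : Nonempty (Fin n) := ⟨⟨0, hn⟩⟩
    infer_instance
  have h1 : ∀ B : Matrix (Fin n) (Fin n) ℝ, ∀ i, B i i ≤ ‖B‖ := by
    intro B i
    have := eNorm_mulVec_le B (Pi.single i 1)
    have e1 : eNorm (Pi.single i 1 : Fin n → ℝ) = 1 := by
      simp [eNorm, Pi.single_apply, Finset.sum_ite]
    rw [e1, mul_one, matNorm_eq'] at this
    refine le_trans ?_ this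
    refine Real.le_sqrt_of_sq_le ?_
    refine le_trans ?_ (Finset.single_le_sum (f := fun l => (B.mulVec (Pi.single i 1) l)^2) (fun _ _ => sq_nonneg _) (Finset.mem_univ i))
    simp
  have h2 : ‖(A * A.transpose)^k‖ ≤ matNorm A ^ (2*k) := by
    rcases Nat.eq_zero_or_pos k with rfl | hk
    · rw [pow_zero, mul_zero, pow_zero]; 
      exact le_of_eq (by simp)
    refine (norm_pow_le' _ hk).trans ?_
    rw [pow_mul]
    gcongr
    rw [matNorm_eq', sq]
    refine (norm_mul_le _ _).trans ?_
    rw [← Matrix.conjTranspose_eq_transpose_of_trivial, Matrix.l2_opNorm_conjTranspose]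
  calc _ = ∑ i, ((A * A.transpose)^k) i i := rfl
    _ ≤ ∑ i : Fin n, matNorm A ^ (2*k) := Finset.sum_le_sum fun i _ => (h1 _ i).trans h2
    _ = _ := by simp

open scoped Matrix.Norms.L2Operator in
lemma le_trace {n : ℕ} (A : Matrix (Fin n) (Fin n) ℝ) (k : ℕ) (hk : 0 < k) :
    matNorm A ^ (2*k) ≤ ((A * A.transpose)^k).trace := by
  set S := A * A.transpose with hS
  have hps : S.PosSemidef := by
    rw [hS, ← Matrix.conjTranspose_eq_transpose_of_trivial]
    exact Matrix.posSemidef_self_mul_conjTranspose A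
  have hn : matNorm A ^ (2*k) = ‖S‖^k := by
    rw [pow_mul, matNorm_eq', hS, ← Matrix.conjTranspose_eq_transpose_of_trivial]
    have := Matrix.l2_opNorm_conjTranspose_mul_self A.conjTranspose
    rw [Matrix.conjTranspose_conjTranspose, Matrix.l2_opNorm_conjTranspose] at this
    rw [this, sq]
  rw [hn]
  have hsp := hps.1.spectral_theorem
  set U := hps.1.eigenvectorUnitary
  set d := hps.1.eigenvalues
  have hd : ∀ i, 0 ≤ d i := hps.eigenvalues_nonneg
  have ht : (S^k).trace = ∑ i, d i ^ k := by
    rw [hsp, ← map_pow, Unitary.conjStarAlgAut_apply, Matrix.trace_mul_cycle]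
    simp [Matrix.diagonal_pow, Matrix.trace_diagonal]
  have hnorm : ‖S‖ = ‖d‖ := by
    conv_lhs => rw [hsp, Unitary.conjStarAlgAut_apply]
    have := Matrix.l2_opNorm_diagonal (𝕜 := ℝ) d
    rw [← this]
    rw [← Unitary.coe_star, CStarRing.norm_mul_coe_unitary, CStarRing.norm_coe_unitary_mul]
    rfl
  rw [ht, hnorm]
  rcases Nat.eq_zero_or_pos n with rfl | hn0
  · have : d = 0 := Subsingleton.elim _ _
    rw [this, norm_zero, zero_pow hk.ne']; simp
  have : Nonempty (Fin n) := ⟨⟨0, hn0⟩⟩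
  obtain ⟨i, hi⟩ := Finite.exists_max d
  have h1 : ‖d‖ ≤ d i := (pi_norm_le_iff_of_nonneg (hd i)).2 fun l => by
    rw [Real.norm_of_nonneg (hd l)]; exact hi l
  calc _ ≤ d i ^ k := by gcongr
    _ ≤ _ := Finset.single_le_sum (f := fun l => d l ^ k) (fun l _ => pow_nonneg (hd l) k) (Finset.mem_univ i)


lemma trace_expand {p : ℝ} {n k : ℕ} (v : Bool → ℝ) :
    Ex p (fun a : Fin n × Fin n → Bool =>
      ((mkM (v ∘ a) * (mkM (v ∘ a)).transpose)^k).trace) =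
    ∑ i : Fin (k+1) → Fin n, ∑ j : Fin k → Fin n, if i 0 = i (Fin.last k) then
      ∏ c, mom p v (Finset.univ.filter (fun s : Fin k × Bool => (i (rix s), j s.1) = c)).card else 0 := by
  simp only [trace_entry]
  rw [Ex_sum]
  refine Finset.sum_congr rfl fun i _ => ?_
  rw [Ex_sum]
  refine Finset.sum_congr rfl fun j _ => ?_
  split_ifs with h
  · rw [← Ex_walk v (fun s : Fin k × Bool => (i (rix s), j s.1))]
    rfl
  · rw [Ex_const]

lemma moment_bound {p : ℝ} (h0 : 0 ≤ p) (h1 : p ≤ 1) {n k : ℕ} (hk : 0 < k) (hnp : (n:ℝ) * p ≤ k) :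
    p * Ex p (fun a : Fin n × Fin n → Bool =>
      matNorm (mkM (bv ∘ a) - Matrix.of fun _ _ => p) ^ (2*k)) ≤ 4 * k * (576 * k : ℝ)^k := by
  classical
  have hX : ∀ a : Fin n × Fin n → Bool, mkM (bv ∘ a) - (Matrix.of fun _ _ => p) =
      mkM ((fun b => bv b - p) ∘ a) := by
    intro a; ext i j; simp [mkM]
  calc _ ≤ p * Ex p (fun a : Fin n × Fin n → Bool =>
      ((mkM ((fun b => bv b - p) ∘ a) * (mkM ((fun b => bv b - p) ∘ a)).transpose)^k).trace) := by
        refine mul_le_mul_of_nonneg_left (Ex_mono h0 h1 fun a => ?_) h0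
        rw [hX]; exact le_trace _ k hk
    _ ≤ ∑ i : Fin (k+1) → Fin n, ∑ j : Fin k → Fin n,
      (if i 0 = i (Fin.last k) ∧ good (fun s : Fin k × Bool => (i (rix s), j s.1)) then (1:ℝ) else 0)
        * p ^ (Finset.univ.image i).card * p ^ (Finset.univ.image j).card := by
        rw [trace_expand, Finset.mul_sum]
        refine Finset.sum_le_sum fun i _ => ?_
        rw [Finset.mul_sum]
        refine Finset.sum_le_sum fun j _ => ?_
        by_cases hc : i 0 = i (Fin.last k)
        · rw [if_pos hc]
          simp only [hc, true_and]
          refine (mul_le_mul_of_nonneg_left (prodX_le h0 h1 (fun s : Fin k × Bool => (i (rix s), j s.1))) h0).trans ?_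
          split_ifs with hg
          · rw [one_mul, ← pow_add, ← pow_succ']
            exact pow_le_pow_of_le_one h0 h1 (connected hk i j)
          · simp
        · simp [hc]
    _ ≤ ∑ i : Fin (k+1) → Fin (2*k), ∑ j : Fin k → Fin (2*k),
      (if i 0 = i (Fin.last k) ∧ good (fun s : Fin k × Bool => (i (rix s), j s.1)) then (1:ℝ) else 0) :=
        shape2 h0 hnp
    _ ≤ Ex (1/3) (fun a : Fin (2*k) × Fin (2*k) → Bool =>
      ((mkM (yv ∘ a) * (mkM (yv ∘ a)).transpose)^k).trace) := by
        rw [trace_expand]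
        refine Finset.sum_le_sum fun i _ => Finset.sum_le_sum fun j _ => ?_
        by_cases hc : i 0 = i (Fin.last k)
        · rw [if_pos hc]
          simp only [hc, true_and]
          exact prodY_ge (fun s : Fin k × Bool => (i (rix s), j s.1))
        · simp [hc]
    _ ≤ Ex (1/3) (fun a : Fin (2*k) × Fin (2*k) → Bool => (2*k : ℝ) * matNorm (mkM (yv ∘ a)) ^ (2*k)) := by
        refine Ex_mono (by norm_num) (by norm_num) fun a => ?_
        have := trace_le (mkM (yv ∘ a)) k
        push_cast at this
        exact this
    _ = (2*k : ℝ) * Ex (1/3) (fun a : Fin (2*k) × Fin (2*k) → Bool => matNorm (mkM (yv ∘ a)) ^ (2*k)) :=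
        Ex_mul_left _ _
    _ ≤ (2*k : ℝ) * (2 * (576 * k : ℝ)^k) := by
        gcongr
        exact Y_moment k hk
    _ = _ := by ring

lemma small_prob {p : ℝ} {n : ℕ} (h0 : 0 ≤ p) (h1 : p ≤ 1) (hl : 4 * Real.log n ≤ n * p)
    (hn : 1000 ≤ Real.log n) :
    1/4 ≤ Ex p (fun a : Fin n × Fin n → Bool =>
      if matNorm (mkM (bv ∘ a) - Matrix.of fun _ _ => p) ≤ 30 * Real.sqrt (n * p) then (1:ℝ) else 0) := by
  set k := ⌈(n:ℝ) * p⌉₊ with hk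
  set L := (n:ℝ) * p with hL
  have hL4 : 4000 ≤ L := by linarith
  have hn0 : (0:ℝ) < n := by
    by_contra h
    have : (n:ℝ) = 0 := le_antisymm (not_lt.1 h) (Nat.cast_nonneg n)
    rw [this, Real.log_zero] at hn; linarith
  have hp : 0 < p := by
    rcases h0.eq_or_lt with h | h
    · rw [hL, ← h] at hL4; norm_num at hL4
    · exact h
  have hk1 : L ≤ k := Nat.le_ceil _
  have hk2 : (k:ℝ) < L + 1 := Nat.ceil_lt_add_one (by linarith)
  have hkpos : 0 < k := Nat.ceil_pos.2 (by linarith)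
  have hmom := moment_bound h0 h1 hkpos hk1
  set N : (Fin n × Fin n → Bool) → ℝ := fun a => matNorm (mkM (bv ∘ a) - Matrix.of fun _ _ => p) with hN
  have hpt : ∀ a, 1 ≤ (if N a ≤ 30 * Real.sqrt L then (1:ℝ) else 0) + ((900 * L)^k)⁻¹ * N a ^ (2*k) := by
    intro a
    have hN0 : 0 ≤ N a := matNorm_nonneg _
    split_ifs with h
    · have : 0 ≤ ((900 * L)^k)⁻¹ * N a ^ (2*k) := by positivity
      linarith
    · rw [zero_add, inv_mul_eq_div, le_div_iff₀ (by positivity), one_mul, pow_mul]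
      gcongr
      have h2 : (30 * Real.sqrt L)^2 = 900 * L := by
        rw [mul_pow, Real.sq_sqrt (by linarith)]; norm_num
      rw [← h2]
      gcongr
      exact (not_le.1 h).le
  have hE : 1 ≤ Ex p (fun a => if N a ≤ 30 * Real.sqrt L then (1:ℝ) else 0) +
      ((900 * L)^k)⁻¹ * Ex p (fun a => N a ^ (2*k)) := by
    rw [← Ex_mul_left, ← Ex_add]
    exact (Ex_one (p := p) (ι := Fin n × Fin n)).symm.le.trans (Ex_mono h0 h1 hpt)
  have hb : ((900 * L)^k)⁻¹ * Ex p (fun a => N a ^ (2*k)) ≤ 3/4 := by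
    have hEx : Ex p (fun a => N a ^ (2*k)) ≤ 4 * k * (576 * k : ℝ)^k / p := by
      rw [le_div_iff₀ hp, mul_comm]; exact hmom
    have hr : (576 * k : ℝ) / (900 * L) ≤ Real.exp (-(2/5)) := by
      have h5 : (0.66:ℝ) ≤ Real.exp (-(2/5)) := by
        rw [Real.exp_neg, le_inv_comm₀ (by norm_num) (Real.exp_pos _)]
        have := Real.exp_bound' (x := 2/5) (by norm_num) (by norm_num) (n := 4) (by norm_num)
        refine this.trans ?_
        norm_num [Finset.sum_range_succ, Nat.factorial]
      refine le_trans ?_ h5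
      rw [div_le_iff₀ (by positivity)]
      linarith
    have hq : ((900 * L)^k)⁻¹ * (576 * k : ℝ)^k ≤ Real.exp (-(8/5) * Real.log n) := by
      rw [inv_mul_eq_div, ← div_pow]
      calc _ ≤ Real.exp (-(2/5)) ^ k := by gcongr
        _ = Real.exp (k * (-(2/5))) := by rw [Real.exp_nat_mul]
        _ ≤ _ := by
          apply Real.exp_le_exp.2
          linarith
    have hkp : 4 * k / p ≤ 5 * n := by
      rw [div_le_iff₀ hp, mul_assoc, ← hL]; linarith
    have hnexp : (n:ℝ) = Real.exp (Real.log n) := (Real.exp_log hn0).symm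
    calc _ ≤ ((900 * L)^k)⁻¹ * (4 * k * (576 * k : ℝ)^k / p) := by gcongr
      _ = (4 * k / p) * (((900 * L)^k)⁻¹ * (576 * k : ℝ)^k) := by ring
      _ ≤ (5 * n) * Real.exp (-(8/5) * Real.log n) := by gcongr
      _ = 5 * Real.exp (-(3/5) * Real.log n) := by
        conv_lhs => rw [hnexp, Real.log_exp]
        rw [mul_assoc, ← Real.exp_add]; congr 2; ring
      _ ≤ 5 * Real.exp (-3) := by gcongr; linarith
      _ ≤ 3/4 := by
        have : (20/3:ℝ) ≤ Real.exp 3 := by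
          have := Real.quadratic_le_exp_of_nonneg (x := 3) (by norm_num)
          norm_num at this; linarith
        rw [Real.exp_neg, ← div_eq_mul_inv, div_le_iff₀ (Real.exp_pos _)]; linarith
  linarith

lemma tail {p : ℝ} {n : ℕ} (h0 : 0 ≤ p) (h1 : p ≤ 1) (hl : 4 * Real.log n ≤ n * p)
    (hn : 1000 ≤ Real.log n) (t : ℝ) (ht : 30 ≤ t) :
    Ex p (fun a : Fin n × Fin n → Bool =>
      if 2 * t * Real.sqrt (n * p) ≤ matNorm (mkM (bv ∘ a) - Matrix.of fun _ _ => p) then (1:ℝ) else 0)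
      ≤ 4 * Real.exp (-(t^2 * p * n / 4)) := by
  have hs := small_prob h0 h1 hl hn
  set q := Real.sqrt (n * p) with hq
  have hq0 : 0 ≤ q := Real.sqrt_nonneg _
  have hc := conc_matrix (n := n) h0 h1 (30 * q) (2 * t * q - 30 * q) (by nlinarith)
  rw [add_sub_cancel] at hc
  set T := Ex p (fun a : Fin n × Fin n → Bool =>
      if 2 * t * q ≤ matNorm (mkM (bv ∘ a) - Matrix.of fun _ _ => p) then (1:ℝ) else 0) with hT
  have hT0 : 0 ≤ T := Ex_nonneg h0 h1 fun a => by split_ifs <;> norm_num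
  have h2 : 1/4 * T ≤ Real.exp (-((2 * t * q - 30 * q)^2/4)) :=
    (mul_le_mul_of_nonneg_right hs hT0).trans hc
  have h3 : Real.exp (-((2 * t * q - 30 * q)^2/4)) ≤ Real.exp (-(t^2 * p * n / 4)) := by
    apply Real.exp_le_exp.2
    have hq2 : q^2 = n * p := Real.sq_sqrt (by positivity)
    have : t^2 * p * n = (t * q)^2 := by rw [mul_pow, hq2]; ring
    rw [this]
    have : (t*q)^2 ≤ (2 * t * q - 30 * q)^2 := by
      apply pow_le_pow_left₀ (by positivity); nlinarith
    linarith
  linarith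


open Classical in
lemma transfer {Ω : Type*} [MeasurableSpace Ω] (μ : Measure Ω) {n : ℕ} {p : ℝ} (h0 : 0 ≤ p) (h1 : p ≤ 1)
    (M : Ω → Matrix (Fin n) (Fin n) ℝ) (hM : IsBernoulliMatrix μ M p)
    (P : Matrix (Fin n) (Fin n) ℝ → Prop) :
    (μ {ω | P (M ω)}).toReal ≤
      Ex p (fun a : Fin n × Fin n → Bool => if P (mkM (bv ∘ a)) then (1:ℝ) else 0) := by
  have hw : ∀ a : Fin n × Fin n → Bool, 0 ≤ ∏ e, bw p (a e) := fun a =>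
    Finset.prod_nonneg fun e _ => bw_nonneg h0 h1 _
  have hμ : ∀ a : Fin n × Fin n → Bool,
      μ {ω | M ω = mkM (bv ∘ a)} = ENNReal.ofReal (∏ e, bw p (a e)) := by
    intro a
    rw [hM.2 _ (by intro i j; simp only [mkM, Matrix.of_apply, Function.comp, bv]; split_ifs <;> simp)]
    congr 1
    simp only [bw]
    rw [Finset.prod_ite, Finset.prod_const, Finset.prod_const]
    congr 3 <;> ext e <;> cases h : a e <;> simp [mkM, bv, h]
  set S := Finset.univ.filter (fun a : Fin n × Fin n → Bool => P (mkM (bv ∘ a))) with hS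
  have hsub : {ω | P (M ω)} ⊆ ⋃ a ∈ S, {ω | M ω = mkM (bv ∘ a)} := by
    intro ω hω
    have he : M ω = mkM (bv ∘ fun e : Fin n × Fin n => decide (M ω e.1 e.2 = 1)) := by
      ext i j
      rcases hM.1 ω i j with h | h <;> simp [mkM, bv, h]
    simp only [Set.mem_iUnion]
    refine ⟨_, ?_, he⟩
    rw [hS, Finset.mem_filter, ← he]
    exact ⟨Finset.mem_univ _, hω⟩
  have hle : μ {ω | P (M ω)} ≤ ENNReal.ofReal (∑ a ∈ S, ∏ e, bw p (a e)) := by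
    refine (measure_mono hsub).trans ((measure_biUnion_finset_le _ _).trans ?_)
    rw [ENNReal.ofReal_sum_of_nonneg fun a _ => hw a]
    exact Finset.sum_le_sum fun a _ => (hμ a).le
  refine (ENNReal.toReal_mono ENNReal.ofReal_ne_top hle).trans ?_
  rw [ENNReal.toReal_ofReal (Finset.sum_nonneg fun a _ => hw a)]
  simp only [Ex, mul_ite, mul_one, mul_zero]
  rw [← Finset.sum_filter]

/-- Norm bounds for Bernoulli(p) matrices: concentration of `‖M - E M‖` and `‖M‖`, and, in
particular, a bound on `‖M𝟏‖`. -/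
theorem norm_bound :
    ∃ n₀ : ℕ, ∀ n : ℕ, n₀ ≤ n → ∀ p : ℝ, 4 * Real.log n / n ≤ p → p ≤ 1 / 4 →
      ∀ (Ω : Type) [MeasurableSpace Ω] (μ : Measure Ω), IsProbabilityMeasure μ →
        ∀ M : Ω → Matrix (Fin n) (Fin n) ℝ, IsBernoulliMatrix μ M p →
          (∀ t : ℝ, 30 ≤ t →
            (μ {ω | 2 * t * Real.sqrt (n * p) ≤
                matNorm (M ω - Matrix.of fun _ _ => p)}).toReal
              ≤ 4 * Real.exp (-(t ^ 2 * p * n / 4)) ∧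
            (μ {ω | 2 * t * Real.sqrt (n * p) + p * n ≤ matNorm (M ω)}).toReal
              ≤ 4 * Real.exp (-(t ^ 2 * p * n / 4))) ∧
          (μ {ω | 3 * p * (n : ℝ) ^ ((3 : ℝ) / 2) ≤
              eNorm ((M ω).mulVec fun _ => 1)}).toReal
            ≤ 4 * Real.exp (-((n : ℝ) ^ 2 * p ^ 2 / 4)) := by
  refine ⟨⌈Real.exp 1000⌉₊, fun n hn p hp1 hp2 Ω _ μ hμ M hM => ?_⟩
  have hnexp : Real.exp 1000 ≤ n := (Nat.le_ceil _).trans (by exact_mod_cast hn)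
  have hn0 : (0:ℝ) < n := (Real.exp_pos _).trans_le hnexp
  have hlog : 1000 ≤ Real.log n := (Real.le_log_iff_exp_le hn0).2 hnexp
  have hl : 4 * Real.log n ≤ n * p := by
    rw [div_le_iff₀ hn0] at hp1; linarith
  have h0 : 0 ≤ p := by
    refine le_trans ?_ hp1
    have : 0 ≤ Real.log n := by linarith
    positivity
  have h1 : p ≤ 1 := by linarith
  have c1 : ∀ t : ℝ, 30 ≤ t → (μ {ω | 2 * t * Real.sqrt (n * p) ≤
                matNorm (M ω - Matrix.of fun _ _ => p)}).toReal
              ≤ 4 * Real.exp (-(t ^ 2 * p * n / 4)) := by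
    intro t ht
    refine (transfer μ h0 h1 M hM (fun A => 2 * t * Real.sqrt (n * p) ≤
                matNorm (A - Matrix.of fun _ _ => p))).trans (le_trans (le_of_eq ?_) (tail h0 h1 hl hlog t ht))
    congr 1
  have c2 : ∀ t : ℝ, 30 ≤ t → (μ {ω | 2 * t * Real.sqrt (n * p) + p * n ≤ matNorm (M ω)}).toReal
              ≤ 4 * Real.exp (-(t ^ 2 * p * n / 4)) := by
    intro t ht
    refine le_trans (ENNReal.toReal_mono (measure_ne_top μ _) (measure_mono ?_)) (c1 t ht)
    intro ω hω
    simp only [Set.mem_ofPred_eq] at hω ⊢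
    have h3 := matNorm_add_le (M ω - Matrix.of fun _ _ => p) (Matrix.of fun _ _ => p)
    rw [sub_add_cancel] at h3
    have h4 := matNorm_const_le (n := n) h0
    linarith
  refine ⟨fun t ht => ⟨c1 t ht, c2 t ht⟩, ?_⟩
  have hnp : 0 ≤ n * p := by positivity
  have ht : 30 ≤ Real.sqrt (n * p) := Real.le_sqrt_of_sq_le (by linarith)
  have c3 := c2 _ ht
  have e1 : Real.sqrt (n*p) ^ 2 * p * n / 4 = (n:ℝ)^2 * p^2 / 4 := by
    rw [Real.sq_sqrt hnp]; ring
  rw [e1, mul_assoc 2, Real.mul_self_sqrt hnp] at c3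
  refine le_trans (ENNReal.toReal_mono (measure_ne_top μ _) (measure_mono ?_)) c3
  intro ω hω
  simp only [Set.mem_ofPred_eq] at hω ⊢
  have h5 := eNorm_mulVec_le (M ω) (fun _ => 1)
  have e2 : eNorm (fun _ : Fin n => (1:ℝ)) = Real.sqrt n := by simp [eNorm]
  have e3 : (n:ℝ) ^ ((3:ℝ)/2) = n * Real.sqrt n := by
    rw [show (3:ℝ)/2 = 1 + 1/2 by norm_num, Real.rpow_add hn0, Real.rpow_one, Real.sqrt_eq_rpow]
  rw [e2] at h5
  rw [e3] at hω
  have h6 : (3 * p * n) * Real.sqrt n ≤ matNorm (M ω) * Real.sqrt n := by linarith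
  have h7 := le_of_mul_le_mul_right h6 (Real.sqrt_pos.2 hn0)
  linarith
end

section
/- Let n ≥ 30 and 0 < p < 0.001 satisfy pn ≥ 200·ln n. Let m and ℓ be integers with either (m = 2 and ℓ = 15), or (m ≥ 30, ℓm ≤ 1/(64p), and ℓ ≤ np/(4·ln(1/(pm)))). Let M be an n×n Bernoulli(p) random matrix, and let E_col be the event that for every choice of two disjoint sets J₁, J₂ ⊆ {1,…,n} with |J₁| = m and |J₂| = ℓm − m there exists a row of M having exactly one entry equal to 1 among the components indexed by J₁ and no entries equal to 1 among the components indexed by J₂. Then P(E_col) ≥ 1 − exp(−1.5·pn). -/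
open MeasureTheory

/-- The row with support `S` is good for `J₁, J₂`. -/
def GoodRow {n : ℕ} (J₁ J₂ S : Finset (Fin n)) : Prop :=
  (J₁.filter fun j => j ∈ S).card = 1 ∧ ∀ j ∈ J₂, j ∉ S

open Classical in
theorem good_row_lower {n : ℕ} (p : ℝ) (hp : 0 ≤ p) (hp1 : p ≤ 1) (J₁ J₂ : Finset (Fin n))
    (hd : Disjoint J₁ J₂) (hm : 1 ≤ J₁.card) :
    (J₁.card : ℝ) * p * (1 - p) ^ (J₁.card + J₂.card - 1) ≤
      ∑ S ∈ Finset.univ.filter (fun S => GoodRow J₁ J₂ S), p ^ S.card * (1 - p) ^ (n - S.card) := by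
  set R := (J₁ ∪ J₂)ᶜ with hR
  have hRc : R.card + (J₁.card + J₂.card) = n := by
    rw [hR, ← Finset.card_union_of_disjoint hd, add_comm, Finset.card_add_card_compl]
    simp
  have hinj : Set.InjOn (fun x : Fin n × Finset (Fin n) => insert x.1 x.2)
      ((J₁ ×ˢ R.powerset : Finset _) : Set (Fin n × Finset (Fin n))) := by
    rintro ⟨a, T⟩ h1 ⟨b, U⟩ h2 h
    simp only [Finset.coe_product, Set.mem_prod, Finset.mem_coe, Finset.mem_powerset] at h1 h2
    simp only at h
    have key : ∀ a ∈ J₁, ∀ T ⊆ R, a ∉ T := by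
      intro a ha T hT haT
      have := hT haT
      simp [hR, ha] at this
    have hab : a = b := by
      have : a ∈ insert b U := h ▸ Finset.mem_insert_self a T
      rcases Finset.mem_insert.1 this with h' | h'
      · exact h'
      · exact absurd h' (key a h1.1 U h2.2)
    subst hab
    have : T = U := by
      rw [← Finset.erase_insert (key a h1.1 T h1.2), h, Finset.erase_insert (key a h1.1 U h2.2)]
    rw [this]
  have hsub : (J₁ ×ˢ R.powerset).image (fun x : Fin n × Finset (Fin n) => insert x.1 x.2) ⊆
      Finset.univ.filter (fun S => GoodRow J₁ J₂ S) := by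
    intro S hS
    simp only [Finset.mem_image, Finset.mem_product, Finset.mem_powerset] at hS
    obtain ⟨⟨a, T⟩, ⟨ha, hT⟩, rfl⟩ := hS
    simp only at ha hT
    have hTn : ∀ j ∈ T, j ∉ J₁ ∧ j ∉ J₂ := by
      intro j hj
      have := hT hj
      simpa [hR] using this
    refine Finset.mem_filter.2 ⟨Finset.mem_univ _, ?_, ?_⟩
    · rw [Finset.card_eq_one]
      refine ⟨a, ?_⟩
      ext j
      simp only [Finset.mem_filter, Finset.mem_insert, Finset.mem_singleton]
      constructor
      · rintro ⟨h1, h2 | h2⟩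
        · exact h2
        · exact absurd h1 (hTn j h2).1
      · rintro rfl
        exact ⟨ha, Or.inl rfl⟩
    · intro j hj hjS
      rcases Finset.mem_insert.1 hjS with h' | h'
      · subst h'
        exact Finset.disjoint_left.1 hd ha hj
      · exact (hTn j h').2 hj
  refine le_trans ?_ (Finset.sum_le_sum_of_subset_of_nonneg hsub ?_)
  · rw [Finset.sum_image hinj, Finset.sum_product]
    have h1 : ∀ a ∈ J₁, ∑ T ∈ R.powerset, p ^ (insert a T).card * (1 - p) ^ (n - (insert a T).card)
        = p * (1 - p) ^ (J₁.card + J₂.card - 1) := by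
      intro a ha
      have : ∀ T ∈ R.powerset, p ^ (insert a T).card * (1 - p) ^ (n - (insert a T).card) =
          (p * (1 - p) ^ (J₁.card + J₂.card - 1)) * (p ^ T.card * (1 - p) ^ (R.card - T.card)) := by
        intro T hT
        rw [Finset.mem_powerset] at hT
        have haT : a ∉ T := by
          intro haT
          have := hT haT
          simp [hR, ha] at this
        have hc := Finset.card_le_card hT
        rw [Finset.card_insert_of_notMem haT]
        have : n - (T.card + 1) = (J₁.card + J₂.card - 1) + (R.card - T.card) := by omega
        rw [this, pow_add, pow_add]
        ring
      rw [Finset.sum_congr rfl this, ← Finset.mul_sum, Finset.sum_pow_mul_eq_add_pow]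
      simp
    simp only
    rw [Finset.sum_congr rfl h1]
    simp [mul_assoc]
  · intro S _ _
    have : 0 ≤ 1 - p := by linarith
    positivity

open Classical in
theorem bad_row_upper {n : ℕ} (p : ℝ) (hp : 0 ≤ p) (hp1 : p ≤ 1) (J₁ J₂ : Finset (Fin n))
    (hd : Disjoint J₁ J₂) (hm : 1 ≤ J₁.card) :
    ∑ S ∈ Finset.univ.filter (fun S => ¬ GoodRow J₁ J₂ S), p ^ S.card * (1 - p) ^ (n - S.card) ≤
     1 - (J₁.card : ℝ) * p * (1 - p) ^ (J₁.card + J₂.card - 1) := by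
  have h1 := good_row_lower p hp hp1 J₁ J₂ hd hm
  have h2 := Finset.sum_filter_add_sum_filter_not (Finset.univ : Finset (Finset (Fin n)))
    (fun S => GoodRow J₁ J₂ S) (fun S => p ^ S.card * (1 - p) ^ (n - S.card))
  have h3 : ∑ S : Finset (Fin n), p ^ S.card * (1 - p) ^ (n - S.card) = 1 := by
    have := Finset.sum_pow_mul_eq_add_pow p (1 - p) (Finset.univ : Finset (Fin n))
    simpa using this
  linarith

/-- The 0/1 matrix with given row supports. -/
noncomputable def suppMat {n : ℕ} (f : Fin n → Finset (Fin n)) : Matrix (Fin n) (Fin n) ℝ :=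
  fun i j => if j ∈ f i then 1 else 0

theorem suppMat_prob {n : ℕ} {Ω : Type} [MeasurableSpace Ω] (μ : Measure Ω)
    (M : Ω → Matrix (Fin n) (Fin n) ℝ) (p : ℝ) (h : IsBernoulliMatrix μ M p)
    (f : Fin n → Finset (Fin n)) :
    μ {ω | M ω = suppMat f} =
      ENNReal.ofReal (∏ i, (p ^ (f i).card * (1 - p) ^ (n - (f i).card))) := by
  rw [h.2 (suppMat f) (by intro i j; unfold suppMat; split_ifs <;> simp)]
  congr 1
  have e1 : (Finset.univ.filter (fun ij : Fin n × Fin n => suppMat f ij.1 ij.2 = 1)).card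
      = ∑ i, (f i).card := by
    rw [Finset.card_filter, Fintype.sum_prod_type]
    refine Finset.sum_congr rfl fun i _ => ?_
    rw [← Finset.card_filter]
    congr 1
    ext j
    simp [suppMat]
  have e2 : (Finset.univ.filter (fun ij : Fin n × Fin n => suppMat f ij.1 ij.2 = 0)).card
      = ∑ i, (n - (f i).card) := by
    rw [Finset.card_filter, Fintype.sum_prod_type]
    refine Finset.sum_congr rfl fun i _ => ?_
    rw [← Finset.card_filter]
    have : n - (f i).card = ((f i)ᶜ).card := by rw [Finset.card_compl]; simp
    rw [this]
    congr 1
    ext j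
    simp [suppMat]
  rw [e1, e2, Finset.prod_mul_distrib, Finset.prod_pow_eq_pow_sum, Finset.prod_pow_eq_pow_sum]

open Classical in
theorem bad_pair_prob {n : ℕ} {Ω : Type} [MeasurableSpace Ω] (μ : Measure Ω)
    (M : Ω → Matrix (Fin n) (Fin n) ℝ) (p : ℝ) (hp : 0 ≤ p) (hp1 : p ≤ 1)
    (h : IsBernoulliMatrix μ M p) (J₁ J₂ : Finset (Fin n))
    (hd : Disjoint J₁ J₂) (hm : 1 ≤ J₁.card) :
    μ {ω | ¬ ∃ i : Fin n, (J₁.filter fun j => M ω i j = 1).card = 1 ∧ ∀ j ∈ J₂, M ω i j = 0} ≤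
      ENNReal.ofReal
        ((1 - (J₁.card : ℝ) * p * (1 - p) ^ (J₁.card + J₂.card - 1)) ^ n) := by
  set B := Finset.univ.filter (fun S => ¬ GoodRow J₁ J₂ S) with hB
  have hp1' : 0 ≤ 1 - p := by linarith
  have hsub : {ω | ¬ ∃ i : Fin n, (J₁.filter fun j => M ω i j = 1).card = 1 ∧
      ∀ j ∈ J₂, M ω i j = 0} ⊆
      ⋃ f ∈ Fintype.piFinset (fun _ : Fin n => B), {ω | M ω = suppMat f} := by
    intro ω hω
    simp only [Set.mem_iUnion, Set.mem_ofPred_eq]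
    refine ⟨fun i => Finset.univ.filter (fun j => M ω i j = 1), ?_, ?_⟩
    · rw [Fintype.mem_piFinset]
      intro i
      refine Finset.mem_filter.2 ⟨Finset.mem_univ _, ?_⟩
      rintro ⟨g1, g2⟩
      simp only [Finset.mem_filter, Finset.mem_univ, true_and] at g1 g2
      refine hω ⟨i, g1, fun j hj => ?_⟩
      exact (h.1 ω i j).resolve_right (g2 j hj)
    · ext i j
      simp only [suppMat, Finset.mem_filter, Finset.mem_univ, true_and]
      rcases h.1 ω i j with h0 | h0 <;> simp [h0]
  refine (measure_mono hsub).trans ((measure_biUnion_finset_le _ _).trans ?_)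
  simp only [suppMat_prob μ M p h]
  rw [← ENNReal.ofReal_sum_of_nonneg (fun f _ => Finset.prod_nonneg fun i _ => by positivity)]
  apply ENNReal.ofReal_le_ofReal
  rw [← Finset.prod_univ_sum (fun _ : Fin n => B)
    (fun _ S => p ^ S.card * (1 - p) ^ (n - S.card))]
  rw [Finset.prod_const, Finset.card_univ, Fintype.card_fin]
  exact pow_le_pow_left₀ (Finset.sum_nonneg fun S _ => by positivity)
    (bad_row_upper p hp hp1 J₁ J₂ hd hm) n

open Classical in
theorem union_bound {n : ℕ} {Ω : Type} [MeasurableSpace Ω] (μ : Measure Ω)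
    [IsProbabilityMeasure μ]
    (M : Ω → Matrix (Fin n) (Fin n) ℝ) (p : ℝ) (hp : 0 ≤ p) (hp1 : p ≤ 1)
    (h : IsBernoulliMatrix μ M p) (m k : ℕ) (hm : 1 ≤ m) (B c : ℝ)
    (hcount : (n : ℝ) ^ m * (n.choose k : ℝ) ≤ Real.exp B)
    (hc : c ≤ (1 - p) ^ (m + k - 1))
    (hB : B + 1.5 * p * n ≤ m * p * c * n) :
    1 - Real.exp (-(1.5 * p * n)) ≤
              (μ {ω | ∀ J₁ J₂ : Finset (Fin n), Disjoint J₁ J₂ →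
                  J₁.card = m → J₂.card = k →
                  ∃ i : Fin n, (J₁.filter fun j => M ω i j = 1).card = 1 ∧
                    ∀ j ∈ J₂, M ω i j = 0}).toReal := by
  set E := {ω | ∀ J₁ J₂ : Finset (Fin n), Disjoint J₁ J₂ →
                  J₁.card = m → J₂.card = k →
                  ∃ i : Fin n, (J₁.filter fun j => M ω i j = 1).card = 1 ∧
                    ∀ j ∈ J₂, M ω i j = 0} with hE
  set P := ((Finset.powersetCard m (Finset.univ : Finset (Fin n))) ×ˢ
    (Finset.powersetCard k (Finset.univ : Finset (Fin n)))).filter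
      (fun x => Disjoint x.1 x.2) with hP
  have hp1' : 0 ≤ 1 - p := by linarith
  set q := (m : ℝ) * p * (1 - p) ^ (m + k - 1) with hq
  have hsub : Eᶜ ⊆ ⋃ x ∈ P, {ω | ¬ ∃ i : Fin n, (x.1.filter fun j => M ω i j = 1).card = 1 ∧
      ∀ j ∈ x.2, M ω i j = 0} := by
    intro ω hω
    simp only [hE, Set.mem_compl_iff, Set.mem_ofPred_eq, not_forall] at hω
    obtain ⟨J₁, J₂, hd, h1, h2, h3⟩ := hω
    simp only [Set.mem_iUnion]
    refine ⟨(J₁, J₂), ?_, h3⟩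
    simp [hP, Finset.mem_powersetCard, h1, h2, hd]
  have hle : μ Eᶜ ≤ ENNReal.ofReal (Real.exp (-(1.5 * p * n))) := by
    by_cases hPe : P = ∅
    · rw [hPe] at hsub
      simp only [Finset.notMem_empty, Set.iUnion_of_empty, Set.iUnion_empty] at hsub
      rw [Set.subset_empty_iff.1 hsub]
      simp
    have hq1 : 0 ≤ 1 - q := by
      obtain ⟨⟨J₁, J₂⟩, hx⟩ := Finset.nonempty_iff_ne_empty.2 hPe
      simp only [hP, Finset.mem_filter, Finset.mem_product, Finset.mem_powersetCard] at hx
      have := bad_row_upper p hp hp1 J₁ J₂ hx.2 (by omega)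
      rw [hx.1.1.2, hx.1.2.2] at this
      refine le_trans (Finset.sum_nonneg fun S _ => by positivity) this
    refine (measure_mono hsub).trans ((measure_biUnion_finset_le _ _).trans ?_)
    have : ∀ x ∈ P, μ {ω | ¬ ∃ i : Fin n, (x.1.filter fun j => M ω i j = 1).card = 1 ∧
      ∀ j ∈ x.2, M ω i j = 0} ≤ ENNReal.ofReal ((1 - q) ^ n) := by
      rintro ⟨J₁, J₂⟩ hx
      simp only [hP, Finset.mem_filter, Finset.mem_product, Finset.mem_powersetCard] at hx
      have := bad_pair_prob μ M p hp hp1 h J₁ J₂ hx.2 (by omega)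
      rw [hx.1.1.2, hx.1.2.2] at this
      exact this
    refine (Finset.sum_le_sum this).trans ?_
    rw [← ENNReal.ofReal_sum_of_nonneg (fun _ _ => by positivity)]
    apply ENNReal.ofReal_le_ofReal
    rw [Finset.sum_const, nsmul_eq_mul]
    have hcard : (P.card : ℝ) ≤ (n : ℝ) ^ m * (n.choose k : ℝ) := by
      have : P.card ≤ n ^ m * n.choose k := by
        refine (Finset.card_filter_le _ _).trans ?_
        rw [Finset.card_product, Finset.card_powersetCard, Finset.card_powersetCard,
          Finset.card_univ, Fintype.card_fin]
        exact Nat.mul_le_mul_right _ (Nat.choose_le_pow n m)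
      exact_mod_cast this
    have hpow : (1 - q) ^ n ≤ Real.exp (-(q * n)) := by
      have h1 : 1 - q ≤ Real.exp (-q) := by
        have := Real.add_one_le_exp (-q)
        linarith
      calc (1 - q) ^ n ≤ (Real.exp (-q)) ^ n := pow_le_pow_left₀ hq1 h1 n
        _ = Real.exp (-(q * n)) := by rw [← Real.exp_nat_mul]; ring_nf
    calc (P.card : ℝ) * (1 - q) ^ n ≤ Real.exp B * Real.exp (-(q * n)) := by
          refine mul_le_mul (hcard.trans hcount) hpow (by positivity) (by positivity)
      _ = Real.exp (B - q * n) := by rw [← Real.exp_add]; ring_nf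
      _ ≤ Real.exp (-(1.5 * p * n)) := by
          apply Real.exp_le_exp.2
          have : m * p * c * n ≤ q * n := by
            rw [hq]
            gcongr
          linarith
  have h1 : 1 ≤ μ E + μ Eᶜ := by
    rw [← measure_univ (μ := μ), ← Set.union_compl_self E]
    exact measure_union_le _ _
  have h2 : (1 : ℝ) ≤ (μ E).toReal + (μ Eᶜ).toReal := by
    rw [← ENNReal.toReal_add (measure_ne_top _ _) (measure_ne_top _ _)]
    have := ENNReal.toReal_mono (by simp) h1
    simpa using this
  have h3 : (μ Eᶜ).toReal ≤ Real.exp (-(1.5 * p * n)) :=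
    ENNReal.toReal_le_of_le_ofReal (Real.exp_nonneg _) hle
  linarith

theorem choose_le_exp (n k K : ℕ) (hk : k ≤ K) (hK : 0 < K) (hKn : K ≤ n) :
    (n.choose k : ℝ) ≤ Real.exp (K * (1 + Real.log (n / K))) := by
  have hn : (0 : ℝ) < n := by exact_mod_cast lt_of_lt_of_le hK hKn
  have hK' : (0 : ℝ) < K := by exact_mod_cast hK
  set x : ℝ := K / n with hx
  have hx0 : 0 < x := by positivity
  have hx1 : x ≤ 1 := by rw [hx, div_le_one hn]; exact_mod_cast hKn
  have h1 : (n.choose k : ℝ) * x ^ k ≤ (1 + x) ^ n := by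
    by_cases hkn : k ≤ n
    · rw [add_comm, add_pow]
      have := Finset.single_le_sum (f := fun i => x ^ i * 1 ^ (n - i) * (n.choose i : ℝ))
        (s := Finset.range (n + 1)) (fun i _ => by positivity)
        (Finset.mem_range.2 (Nat.lt_succ_of_le hkn))
      simp only [one_pow, mul_one] at this ⊢
      linarith
    · omega
  have h2 : (1 + x) ^ n ≤ Real.exp K := by
    calc (1 + x) ^ n ≤ (Real.exp x) ^ n := by
          refine pow_le_pow_left₀ (by positivity) ?_ n
          linarith [Real.add_one_le_exp x]
      _ = Real.exp K := by
          rw [← Real.exp_nat_mul, hx]; congr 1; field_simp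
  have h3 : x ^ K ≤ x ^ k := pow_le_pow_of_le_one hx0.le hx1 hk
  have h4 : Real.exp (K * (1 + Real.log (n / K))) = Real.exp K / x ^ K := by
    have : (n : ℝ) / K = x⁻¹ := by rw [hx, inv_div]
    rw [this, Real.log_inv, mul_add, Real.exp_add, mul_one, mul_neg, Real.exp_neg,
      Real.exp_nat_mul, Real.exp_log hx0, div_eq_mul_inv]
  rw [h4, le_div_iff₀ (by positivity)]
  calc (n.choose k : ℝ) * x ^ K ≤ (n.choose k : ℝ) * x ^ k := by gcongr
    _ ≤ _ := h1.trans h2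

theorem pow_eq_exp_log (n m : ℕ) (hn : 0 < n) : (n : ℝ) ^ m = Real.exp (m * Real.log n) := by
  rw [Real.exp_nat_mul, Real.exp_log (by exact_mod_cast hn)]

/-- With high probability, for every pair of disjoint index sets `J₁, J₂` of prescribed sizes
there is a row with exactly one `1` in `J₁` and no `1`s in `J₂`. -/
theorem exists_good_row :
    ∀ n : ℕ, 30 ≤ n → ∀ p : ℝ, 0 < p → p < 0.001 → 200 * Real.log n ≤ p * n →
      ∀ m l : ℕ,
        ((m = 2 ∧ l = 15) ∨
          (30 ≤ m ∧ ((l * m : ℕ) : ℝ) ≤ 1 / (64 * p) ∧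
            (l : ℝ) ≤ (n : ℝ) * p / (4 * Real.log (1 / (p * m))))) →
        ∀ (Ω : Type) [MeasurableSpace Ω] (μ : Measure Ω), IsProbabilityMeasure μ →
          ∀ M : Ω → Matrix (Fin n) (Fin n) ℝ, IsBernoulliMatrix μ M p →
            1 - Real.exp (-(1.5 * p * n)) ≤
              (μ {ω | ∀ J₁ J₂ : Finset (Fin n), Disjoint J₁ J₂ →
                  J₁.card = m → J₂.card = l * m - m →
                  ∃ i : Fin n, (J₁.filter fun j => M ω i j = 1).card = 1 ∧
                    ∀ j ∈ J₂, M ω i j = 0}).toReal := by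
  intro n hn p hp0 hp1 hlog m l hml Ω _ μ hμ M hM
  have hn' : (30 : ℝ) ≤ n := by exact_mod_cast hn
  have hp1' : p < 1 / 1000 := by norm_num at hp1 ⊢; exact hp1
  have hlogn : 1 ≤ Real.log n := by
    rw [Real.le_log_iff_exp_le (by linarith)]
    linarith [Real.exp_one_lt_d9]
  have hpn : 200 ≤ p * n := by linarith
  have hL0 : 0 ≤ Real.log n := by linarith
  rcases hml with ⟨rfl, rfl⟩ | ⟨hm, hlm, hl⟩
  · -- the case m = 2, l = 15
    refine union_bound μ M p hp0.le (by linarith) hM 2 (15 * 2 - 2) (by norm_num)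
      (30 * Real.log n) (1 - 29 * p) ?_ ?_ ?_
    · have h1 : (n.choose (15 * 2 - 2) : ℝ) ≤ (n : ℝ) ^ 28 := by
        exact_mod_cast Nat.choose_le_pow n 28
      have h2 := pow_eq_exp_log n 30 (by omega)
      push_cast at h2
      rw [← h2]
      calc (n : ℝ) ^ 2 * (n.choose (15 * 2 - 2) : ℝ) ≤ (n : ℝ) ^ 2 * (n : ℝ) ^ 28 := by gcongr
        _ = (n : ℝ) ^ 30 := by ring
    · have := one_add_mul_le_pow (a := -p) (by linarith) 29
      norm_num at this ⊢
      rw [← sub_eq_add_neg] at this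
      linarith
    · push_cast
      nlinarith
  have hm' : (30 : ℝ) ≤ m := by exact_mod_cast hm
  have hm0 : (0 : ℝ) < m := by linarith
  have hpm : 0 < p * m := by positivity
  have hX : 0 < p * n * m := by positivity
  have hXL : m * Real.log n ≤ p * n * m / 200 := by nlinarith
  have hX3 : 1.5 * p * n ≤ p * n * m / 20 := by
    have : p * n * 30 ≤ p * n * m := by gcongr
    linarith
  rcases Nat.eq_zero_or_pos l with rfl | hl0
  · -- degenerate case l = 0
    have hpm1 : p * m ≤ 1 := by
      by_contra hcon
      push Not at hcon
      have h1 : Real.log (1 / (p * m)) < 0 := by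
        apply Real.log_neg (by positivity)
        rw [div_lt_one hpm]; exact hcon
      have h2 : (n : ℝ) * p / (4 * Real.log (1 / (p * m))) < 0 :=
        div_neg_of_pos_of_neg (by positivity) (by linarith)
      push_cast at hl
      linarith
    refine union_bound μ M p hp0.le (by linarith) hM m (0 * m - m) (by omega)
      (m * Real.log n) (1 / 9) ?_ ?_ ?_
    · simp [pow_eq_exp_log n m (by omega)]
    · have hk : 0 * m - m = 0 := by omega
      rw [hk, add_zero]
      have h1 : Real.exp (-(2 * p)) ≤ 1 - p := by
        rw [Real.exp_neg]
        apply inv_le_of_inv_le₀ (by linarith)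
        have := Real.add_one_le_exp (2 * p)
        refine le_trans ?_ this
        rw [inv_le_iff_one_le_mul₀ (by linarith)]
        nlinarith
      have h2 : (1 - p) ^ m ≤ (1 - p) ^ (m - 1) :=
        pow_le_pow_of_le_one (by linarith) (by linarith) (by omega)
      refine le_trans ?_ h2
      refine le_trans ?_ (pow_le_pow_left₀ (Real.exp_nonneg _) h1 m)
      rw [← Real.exp_nat_mul]
      have h3 : Real.exp (-2) ≤ Real.exp (m * -(2 * p)) := by
        apply Real.exp_le_exp.2; nlinarith
      refine le_trans ?_ h3
      rw [Real.exp_neg, one_div]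
      apply inv_anti₀ (Real.exp_pos _)
      have : Real.exp 2 = Real.exp 1 ^ 2 := by rw [← Real.exp_nat_mul]; norm_num
      rw [this]
      have := Real.exp_one_lt_d9
      nlinarith [Real.exp_pos 1]
    · nlinarith
  · have hl1 : (1 : ℝ) ≤ l := by exact_mod_cast hl0
    have hlmp : (l : ℝ) * m * p ≤ 1 / 64 := by
      rw [le_div_iff₀ (by positivity)] at hlm
      push_cast at hlm
      linarith
    have hpm64 : p * m ≤ 1 / 64 := by nlinarith
    set L := Real.log (1 / (p * m)) with hLdef
    have hL4 : 4 ≤ L := by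
      rw [hLdef, Real.le_log_iff_exp_le (by positivity)]
      have h64 : 64 ≤ 1 / (p * m) := by
        rw [le_div_iff₀ hpm]; linarith
      have : Real.exp 4 = Real.exp 1 ^ 4 := by rw [← Real.exp_nat_mul]; norm_num
      rw [this]
      have h1 := Real.exp_one_lt_d9
      have : Real.exp 1 ^ 4 ≤ 2.7182818286 ^ 4 := pow_le_pow_left₀ (Real.exp_nonneg _) h1.le 4
      refine le_trans (this.trans ?_) h64
      norm_num
    have hlL : l * L * 4 ≤ p * n := by
      rw [le_div_iff₀ (by linarith)] at hl
      linarith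
    have hK : l * m ≤ n := by
      have : ((l * m : ℕ) : ℝ) ≤ n := by
        push_cast
        have h1 : (l : ℝ) * m * p ≤ n * p := by linarith
        exact le_of_mul_le_mul_right h1 hp0
      exact_mod_cast this
    have hKpos : 0 < l * m := by positivity
    refine union_bound μ M p hp0.le (by linarith) hM m (l * m - m) (by omega)
      (m * Real.log n + ((l * m : ℕ) : ℝ) * (1 + Real.log (n / (l * m : ℕ)))) (63 / 64) ?_ ?_ ?_
    · rw [Real.exp_add, pow_eq_exp_log n m (by omega)]
      gcongr
      exact choose_le_exp n (l * m - m) (l * m) (by omega) hKpos hK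
    · have h1 := one_add_mul_le_pow (a := -p) (by linarith) (l * m)
      have h2 : (1 - p) ^ (l * m) ≤ (1 - p) ^ (m + (l * m - m) - 1) := by
        refine pow_le_pow_of_le_one (by linarith) (by linarith) ?_
        have : m ≤ l * m := Nat.le_mul_of_pos_left m hl0
        omega
      push_cast at h1
      rw [← sub_eq_add_neg] at h1
      linarith
    · push_cast
      have hl0' : (0 : ℝ) < l := by linarith
      have hn0 : (0 : ℝ) < n := by linarith
      have e : (n : ℝ) / (l * m) = 1 / (p * m) * (p * n / l) := by field_simp
      have hlog2 : Real.log (p * n / l) ≤ p * n / l / 2 := by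
        have hy : 0 < p * n / l := by positivity
        have h1 := Real.log_le_sub_one_of_pos (x := p * n / l / 2) (by positivity)
        rw [Real.log_div hy.ne' (by norm_num)] at h1
        have := Real.log_two_lt_d9
        linarith
      rw [e, Real.log_mul (by positivity) (by positivity), ← hLdef]
      have a1 : (l : ℝ) * m * Real.log (p * n / l) ≤ p * n * m / 2 := by
        calc (l : ℝ) * m * Real.log (p * n / l) ≤ l * m * (p * n / l / 2) := by gcongr
          _ = p * n * m / 2 := by field_simp
      have a2 : (l : ℝ) * m * L ≤ p * n * m / 4 := by nlinarith
      have a3 : (l : ℝ) * m ≤ p * n * m / 16 := by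
        have : (l : ℝ) * m * 4 ≤ l * m * L := by gcongr
        linarith
      linarith
end
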